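/- There exist constants ε₀ > 0 and C > 0 depending only on k such that the following holds (Fourier concentration on high degrees). Let 0 < ε ≤ ε₀, let μ be an ε-product probability measure on V = V₁×⋯×V_k, let d ≤ k, let δ > 0, and let f : V → {0,1} be (d,δ)-global. Then ‖f^{≤d}‖₂² ≤ (C·√ε + (200d)^d·δ^{1/2})·‖f‖₂². -/

import Mathlib

open Finset

namespace GLL

variable {k : ℕ} {V : Fin k → Type} [∀ i, Fintype (V i)] [∀ i, DecidableEq (V i)]

/-- Expectation of `f` with respect to the (finitely supported) measure `μ`. -/
def expect (μ f : (∀ i, V i) → ℝ) : ℝ := ∑ x, μ x * f x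

/-- `μ` is a probability measure. -/
def IsProb (μ : (∀ i, V i) → ℝ) : Prop := (∀ x, 0 ≤ μ x) ∧ ∑ x, μ x = 1

/-- The marginal `μ_S` evaluated at (the `S`-coordinates of) `x`. -/
def marg (μ : (∀ i, V i) → ℝ) (S : Finset (Fin k)) (x : ∀ i, V i) : ℝ :=
  ∑ z, if ∀ i ∈ S, z i = x i then μ z else 0

/-- The link (conditional) measure `μ_x` for `x ∈ V_S`, viewed as a measure on
full points agreeing with `x` on `S`. -/
noncomputable def cond (μ : (∀ i, V i) → ℝ) (S : Finset (Fin k)) (x z : ∀ i, V i) : ℝ :=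
  if ∀ i ∈ S, z i = x i then μ z / marg μ S x else 0

/-- The averaging operator `A_S`: `A_S f (x) = E_{y ∼ μ_{x_S}} [f(x_S, y)]`.
Applied to an `S'`-junta `f`, this is also the operator `A_{S',S}`. -/
noncomputable def Aop (μ : (∀ i, V i) → ℝ) (S : Finset (Fin k)) (f : (∀ i, V i) → ℝ)
    (x : ∀ i, V i) : ℝ :=
  ∑ z, cond μ S x z * f z

/-- The Efron–Stein component `f^{=S} = ∑_{T ⊆ S} (-1)^{|S∖T|} A_T f`. -/
noncomputable def ES (μ : (∀ i, V i) → ℝ) (S : Finset (Fin k)) (f : (∀ i, V i) → ℝ)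
    (x : ∀ i, V i) : ℝ :=
  ∑ T ∈ S.powerset, (-1 : ℝ) ^ (S.card - T.card) * Aop μ T f x

/-- The low-degree part `f^{≤ d} = ∑_{|S| ≤ d} f^{=S}`. -/
noncomputable def lowPart (μ : (∀ i, V i) → ℝ) (d : ℕ) (f : (∀ i, V i) → ℝ)
    (x : ∀ i, V i) : ℝ :=
  ∑ S ∈ univ.powerset.filter (fun S : Finset (Fin k) => S.card ≤ d), ES μ S f x

/-- The Laplacian `L_S[f] = ∑_{T ⊇ S} f^{=T}`. -/
noncomputable def Lap (μ : (∀ i, V i) → ℝ) (S : Finset (Fin k)) (f : (∀ i, V i) → ℝ)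
    (x : ∀ i, V i) : ℝ :=
  ∑ T ∈ univ.powerset.filter (fun T : Finset (Fin k) => S ⊆ T), ES μ T f x

/-- The truncated Laplacian `L_S^{≤d}[f] = ∑_{T ⊇ S, |T| ≤ d} f^{=T}`. -/
noncomputable def LapLe (μ : (∀ i, V i) → ℝ) (d : ℕ) (S : Finset (Fin k))
    (f : (∀ i, V i) → ℝ) (x : ∀ i, V i) : ℝ :=
  ∑ T ∈ univ.powerset.filter (fun T : Finset (Fin k) => S ⊆ T ∧ T.card ≤ d), ES μ T f x

/-- The influence `I_{S,x}[f] = ‖L_S[f](x,·)‖²_{L²(μ_x)}`. -/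
noncomputable def Inf (μ : (∀ i, V i) → ℝ) (S : Finset (Fin k)) (f : (∀ i, V i) → ℝ)
    (x : ∀ i, V i) : ℝ :=
  ∑ z, cond μ S x z * (Lap μ S f z) ^ 2

/-- The truncated influence `I^{≤d}_{S,x}[f] = ‖L_S^{≤d}[f](x,·)‖²_{L²(μ_x)}`. -/
noncomputable def InfLe (μ : (∀ i, V i) → ℝ) (d : ℕ) (S : Finset (Fin k))
    (f : (∀ i, V i) → ℝ) (x : ∀ i, V i) : ℝ :=
  ∑ z, cond μ S x z * (LapLe μ d S f z) ^ 2

/-- `‖f‖₂²` with respect to `μ`. -/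
def normSq (μ f : (∀ i, V i) → ℝ) : ℝ := ∑ x, μ x * (f x) ^ 2

/-- `‖f‖₄⁴` with respect to `μ`. -/
def norm4p4 (μ f : (∀ i, V i) → ℝ) : ℝ := ∑ x, μ x * (f x) ^ 4

/-- `‖f‖₂` with respect to `μ`. -/
noncomputable def l2norm (μ f : (∀ i, V i) → ℝ) : ℝ := Real.sqrt (normSq μ f)

/-- `‖f‖_∞`: the maximum of `|f|` over the support of `μ`. -/
noncomputable def supNorm (μ f : (∀ i, V i) → ℝ) : ℝ :=
  sSup ((fun x => |f x|) '' {x | 0 < μ x})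

/-- Inner product `⟨f, g⟩ = E_{x∼μ}[f(x) g(x)]`. -/
def inner' (μ f g : (∀ i, V i) → ℝ) : ℝ := ∑ x, μ x * (f x * g x)

/-- The pair `{i,j}`-skeleton of `μ` is `ε`-pseudorandom. -/
def PairPseudo (μ : (∀ i, V i) → ℝ) (ε : ℝ) (i j : Fin k) : Prop :=
  ∀ (f₁ : V i → ℝ) (f₂ : V j → ℝ),
    |expect μ (fun x => f₁ (x i) * f₂ (x j)) -
        expect μ (fun x => f₁ (x i)) * expect μ (fun x => f₂ (x j))| ≤
      ε * Real.sqrt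
        ((expect μ (fun x => f₁ (x i) ^ 2) - expect μ (fun x => f₁ (x i)) ^ 2) *
          (expect μ (fun x => f₂ (x j) ^ 2) - expect μ (fun x => f₂ (x j)) ^ 2))

/-- `μ` is an `ε`-product measure: every link of every restriction of size `≤ k - 2`
has `ε`-pseudorandom skeletons. -/
def EpsProduct (μ : (∀ i, V i) → ℝ) (ε : ℝ) : Prop :=
  ∀ S : Finset (Fin k), S.card ≤ k - 2 → ∀ x, 0 < marg μ S x →
    ∀ i j : Fin k, i ∉ S → j ∉ S → i ≠ j → PairPseudo (cond μ S x) ε i j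

/-- `‖f(x,·)‖_{L²(μ_x)}` for `x ∈ V_S`. -/
noncomputable def restrictNorm (μ : (∀ i, V i) → ℝ) (S : Finset (Fin k)) (x : ∀ i, V i)
    (f : (∀ i, V i) → ℝ) : ℝ :=
  Real.sqrt (∑ z, cond μ S x z * (f z) ^ 2)

/-- `f` is `(d, δ)`-global: all restrictions of at most `d` coordinates have
`2`-norm at most `δ`. -/
def IsGlobal (μ : (∀ i, V i) → ℝ) (d : ℕ) (δ : ℝ) (f : (∀ i, V i) → ℝ) : Prop :=
  ∀ S : Finset (Fin k), S.card ≤ d → ∀ x, 0 < marg μ S x → restrictNorm μ S x f ≤ δ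

/-- `f` is an `S`-junta: it depends only on the coordinates in `S`. -/
def Junta (S : Finset (Fin k)) (f : (∀ i, V i) → ℝ) : Prop :=
  ∀ x y, (∀ i ∈ S, x i = y i) → f x = f y

/-- The noise operator `T_ρ f = ∑_{S ⊆ [k]} ρ^{|S|} (1-ρ)^{k-|S|} A_S f`. -/
noncomputable def noiseOp (μ : (∀ i, V i) → ℝ) (ρ : ℝ) (f : (∀ i, V i) → ℝ)
    (x : ∀ i, V i) : ℝ :=
  ∑ S ∈ (univ : Finset (Fin k)).powerset, ρ ^ S.card * (1 - ρ) ^ (k - S.card) * Aop μ S f x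

/-- The up-down walk operator `T = (1/k) ∑_{i=1}^k A_{[k]∖{i}}`. -/
noncomputable def upDown (μ : (∀ i, V i) → ℝ) (f : (∀ i, V i) → ℝ) (x : ∀ i, V i) : ℝ :=
  (1 / (k : ℝ)) * ∑ i : Fin k, Aop μ (univ.erase i) f x

/-- The product measure `μ₁ ⊗ ⋯ ⊗ μ_k`. -/
def prodMeasure (μi : ∀ i, V i → ℝ) : (∀ i, V i) → ℝ := fun x => ∏ i, μi i (x i)

/-- `f` has degree at most `d`: `f^{=S} = 0` whenever `|S| > d`. -/
def DegLe (μ : (∀ i, V i) → ℝ) (d : ℕ) (f : (∀ i, V i) → ℝ) : Prop :=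
  ∀ S : Finset (Fin k), d < S.card → ∀ x, ES μ S f x = 0

/-- `{F S}_{S ⊆ [k]}` is an `(α, ε')`-approximate Efron–Stein decomposition of `f`. -/
noncomputable def ApproxES (μ : (∀ i, V i) → ℝ) (α ε' : ℝ) (f : (∀ i, V i) → ℝ)
    (F : Finset (Fin k) → (∀ i, V i) → ℝ) : Prop :=
  l2norm μ f ≤ α ∧
    l2norm μ (fun x => f x - ∑ S ∈ (univ : Finset (Fin k)).powerset, F S x) ≤ ε' ∧
    ∀ S : Finset (Fin k), ∃ h : (∀ i, V i) → ℝ,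
      l2norm μ h ≤ α ∧ l2norm μ (fun x => ES μ S h x - F S x) ≤ ε'

set_option linter.unusedSectionVars false

variable {μ f g u v φ : (∀ i, V i) → ℝ} {S T : Finset (Fin k)} {x z : ∀ i, V i}

theorem Junta.mono (h : Junta S f) (hST : S ⊆ T) : Junta T f :=
  fun x y hxy => h x y fun i hi => hxy i (hST hi)

theorem Junta.mul (hf : Junta S f) (hg : Junta S g) : Junta S (fun x => f x * g x) :=
  fun x y h => by simp only [hf x y h, hg x y h]

theorem Junta.mul_union (hf : Junta S f) (hg : Junta T g) :
    Junta (S ∪ T) (fun x => f x * g x) :=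
  (hf.mono subset_union_left).mul (hg.mono subset_union_right)

theorem Junta.sq (hf : Junta S f) : Junta S (fun x => f x ^ 2) :=
  fun x y h => by simp only [hf x y h]

theorem marg_congr (h : ∀ i ∈ S, z i = x i) : marg μ S z = marg μ S x := by
  unfold marg
  refine sum_congr rfl fun y _ => if_congr ?_ rfl rfl
  exact forall₂_congr fun i hi => by rw [h i hi]

theorem marg_nonneg (hμ : ∀ x, 0 ≤ μ x) : 0 ≤ marg μ S x :=
  sum_nonneg fun z _ => by split_ifs <;> simp [hμ z]

theorem marg_pos (hμ : ∀ x, 0 ≤ μ x) (hx : 0 < μ x) : 0 < marg μ S x := by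
  refine sum_pos' (fun z _ => by split_ifs <;> simp [hμ z]) ⟨x, mem_univ x, ?_⟩
  simpa using hx

theorem cond_nonneg (hμ : ∀ x, 0 ≤ μ x) : 0 ≤ cond μ S x z := by
  unfold cond
  split_ifs
  exacts [div_nonneg (hμ z) (marg_nonneg hμ), le_rfl]

theorem mul_cond_comm : μ x * cond μ S x z = μ z * cond μ S z x := by
  unfold cond
  by_cases h : ∀ i ∈ S, z i = x i
  · rw [if_pos h, if_pos fun i hi => (h i hi).symm, marg_congr h]
    ring
  · rw [if_neg h, if_neg fun h' => h fun i hi => (h' i hi).symm]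
    simp

theorem sum_cond (hx : marg μ S x ≠ 0) : ∑ z, cond μ S x z = 1 := by
  have : ∀ z, cond μ S x z = (if ∀ i ∈ S, z i = x i then μ z else 0) / marg μ S x := by
    intro z
    unfold cond
    split_ifs <;> simp
  simp only [this, ← sum_div]
  exact div_self hx

theorem sum_cond_le_one : ∑ z, cond μ S x z ≤ 1 := by
  by_cases hx : marg μ S x = 0
  · have : ∀ z, cond μ S x z = 0 := fun z => by
      unfold cond
      simp [hx]
    simp [this]
  · exact (sum_cond hx).le

theorem inner_comm : inner' μ f g = inner' μ g f := by
  simp only [inner', mul_comm (f _)]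

theorem inner_Aop_left : inner' μ (Aop μ S f) g = inner' μ f (Aop μ S g) := by
  simp only [inner', Aop, sum_mul, mul_sum]
  rw [sum_comm]
  refine sum_congr rfl fun z _ => sum_congr rfl fun x _ => ?_
  have := mul_cond_comm (μ := μ) (S := S) (x := x) (z := z)
  linear_combination (f z * g x) * this

theorem Aop_mul_junta (hφ : Junta S φ) :
    Aop μ S (fun x => φ x * f x) x = φ x * Aop μ S f x := by
  simp only [Aop, mul_sum]
  refine sum_congr rfl fun z _ => ?_
  unfold cond
  split_ifs with h
  · rw [hφ z x h]
    ring
  · simp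

theorem Aop_eq_self (hφ : Junta S φ) (hx : marg μ S x ≠ 0) : Aop μ S φ x = φ x := by
  have h := Aop_mul_junta (μ := μ) (f := fun _ => 1) (x := x) hφ
  simp only [mul_one] at h
  rw [h]
  simp [Aop, sum_cond hx]

theorem junta_Aop : Junta S (Aop μ S f) := by
  intro x y h
  unfold Aop
  refine sum_congr rfl fun z _ => ?_
  congr 1
  unfold cond
  rw [marg_congr h]
  exact if_congr (forall₂_congr fun i hi => by rw [h i hi]) rfl rfl

theorem inner_Aop_of_junta (hμ : ∀ x, 0 ≤ μ x) (hg : Junta S g) :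
    inner' μ (Aop μ S f) g = inner' μ f g := by
  rw [inner_Aop_left]
  refine sum_congr rfl fun x _ => ?_
  rcases (hμ x).eq_or_lt with h | h
  · simp [← h]
  · rw [Aop_eq_self hg (marg_pos hμ h).ne']

theorem inner_Aop_Aop_of_subset (hμ : ∀ x, 0 ≤ μ x) (h : S ⊆ T) :
    inner' μ (Aop μ S (Aop μ T f)) g = inner' μ (Aop μ S f) g := by
  rw [inner_Aop_left, inner_Aop_of_junta hμ (junta_Aop.mono h), inner_Aop_left]

theorem Aop_nonneg (hμ : ∀ x, 0 ≤ μ x) (hf : ∀ x, 0 ≤ f x) : 0 ≤ Aop μ S f x :=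
  sum_nonneg fun z _ => mul_nonneg (cond_nonneg hμ) (hf z)

theorem abs_Aop_le (hμ : ∀ x, 0 ≤ μ x) {b : ℝ} (hb : 0 ≤ b) (hf : ∀ x, |f x| ≤ b) :
    |Aop μ S f x| ≤ b := by
  calc |Aop μ S f x| ≤ ∑ z, |cond μ S x z * f z| := abs_sum_le_sum_abs _ _
    _ ≤ ∑ z, cond μ S x z * b := by
        refine sum_le_sum fun z _ => ?_
        rw [abs_mul, abs_of_nonneg (cond_nonneg hμ)]
        exact mul_le_mul_of_nonneg_left (hf z) (cond_nonneg hμ)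
    _ ≤ b := by
        rw [← sum_mul]
        exact mul_le_of_le_one_left hb sum_cond_le_one

theorem sq_Aop_mul_le (hμ : ∀ x, 0 ≤ μ x) :
    Aop μ S (fun x => f x * g x) x ^ 2 ≤
      Aop μ S (fun x => f x ^ 2) x * Aop μ S (fun x => g x ^ 2) x :=
  sum_sq_le_sum_mul_sum_of_sq_le_mul _
    (fun z _ => mul_nonneg (cond_nonneg hμ) (sq_nonneg _))
    (fun z _ => mul_nonneg (cond_nonneg hμ) (sq_nonneg _)) fun z _ => by ring_nf; rfl

theorem sq_Aop_le (hμ : ∀ x, 0 ≤ μ x) : Aop μ S f x ^ 2 ≤ Aop μ S (fun x => f x ^ 2) x := by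
  have h := sq_Aop_mul_le (f := f) (g := fun _ => 1) (S := S) (x := x) hμ
  simp only [mul_one, one_pow] at h
  refine h.trans (mul_le_of_le_one_right (Aop_nonneg hμ fun _ => sq_nonneg _) ?_)
  exact (le_abs_self _).trans (abs_Aop_le hμ zero_le_one (by simp))

theorem normSq_eq_inner : normSq μ f = inner' μ f f := by
  simp only [normSq, inner', sq]

theorem normSq_eq_inner_one : normSq μ f = inner' μ (fun x => f x ^ 2) (fun _ => 1) := by
  simp only [normSq, inner', mul_one]

theorem normSq_nonneg (hμ : ∀ x, 0 ≤ μ x) : 0 ≤ normSq μ f :=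
  sum_nonneg fun x _ => mul_nonneg (hμ x) (sq_nonneg _)

theorem normSq_mono (hμ : ∀ x, 0 ≤ μ x) (h : ∀ x, |f x| ≤ |g x|) : normSq μ f ≤ normSq μ g :=
  sum_le_sum fun x _ => mul_le_mul_of_nonneg_left (sq_le_sq.2 (h x)) (hμ x)

theorem normSq_const_mul (c : ℝ) : normSq μ (fun x => c * f x) = c ^ 2 * normSq μ f := by
  simp only [normSq, mul_sum]
  exact sum_congr rfl fun x _ => by ring

theorem sq_inner_le (hμ : ∀ x, 0 ≤ μ x) : inner' μ f g ^ 2 ≤ normSq μ f * normSq μ g :=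
  sum_sq_le_sum_mul_sum_of_sq_le_mul _
    (fun z _ => mul_nonneg (hμ z) (sq_nonneg _))
    (fun z _ => mul_nonneg (hμ z) (sq_nonneg _)) fun z _ => by ring_nf; rfl

theorem l2norm_nonneg : 0 ≤ l2norm μ f := Real.sqrt_nonneg _

theorem l2norm_sq (hμ : ∀ x, 0 ≤ μ x) : l2norm μ f ^ 2 = normSq μ f :=
  Real.sq_sqrt (normSq_nonneg hμ)

theorem l2norm_le_of_normSq_le (hμ : ∀ x, 0 ≤ μ x) {c : ℝ} (hc : 0 ≤ c)
    (h : normSq μ f ≤ c ^ 2 * normSq μ g) : l2norm μ f ≤ c * l2norm μ g := by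
  refine Real.sqrt_le_iff.2 ⟨mul_nonneg hc l2norm_nonneg, ?_⟩
  rwa [mul_pow, l2norm_sq hμ]

theorem inner_le_inner (hμ : ∀ x, 0 ≤ μ x) (h : ∀ x, f x * g x ≤ u x * v x) :
    inner' μ f g ≤ inner' μ u v :=
  sum_le_sum fun x _ => mul_le_mul_of_nonneg_left (h x) (hμ x)

theorem normSq_Aop_le (hμ : ∀ x, 0 ≤ μ x) : normSq μ (Aop μ S f) ≤ normSq μ f := by
  rw [normSq_eq_inner_one, normSq_eq_inner_one,
    ← inner_Aop_of_junta (S := S) (f := fun x => f x ^ 2) hμ fun _ _ _ => rfl]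
  exact inner_le_inner hμ fun x => by simpa using sq_Aop_le hμ

theorem l2norm_Aop_le (hμ : ∀ x, 0 ≤ μ x) : l2norm μ (Aop μ S f) ≤ l2norm μ f :=
  Real.sqrt_le_sqrt (normSq_Aop_le hμ)

theorem inner_sum_left {ι : Type*} (s : Finset ι) (F : ι → (∀ i, V i) → ℝ) :
    inner' μ (fun x => ∑ j ∈ s, F j x) g = ∑ j ∈ s, inner' μ (F j) g := by
  simp only [inner', sum_mul, mul_sum]
  rw [sum_comm]

theorem inner_const_mul_left (c : ℝ) : inner' μ (fun x => c * f x) g = c * inner' μ f g := by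
  simp only [inner', mul_sum]
  exact sum_congr rfl fun x _ => by ring

theorem abs_sum_sub_sum_le {ι : Type*} (s : Finset ι) {a b : ι → ℝ} {c : ℝ}
    (h : ∀ j ∈ s, |a j - b j| ≤ c) : |∑ j ∈ s, a j - ∑ j ∈ s, b j| ≤ s.card * c := by
  rw [← sum_sub_distrib]
  refine (abs_sum_le_sum_abs _ _).trans ((sum_le_sum h).trans ?_)
  simp

/-- An `S`-junta `u` and a `T`-junta `v` correlate, up to `c ‖u‖ ‖v‖`, only through `S ∩ T`. -/
def SwapBound (μ : (∀ i, V i) → ℝ) (S T : Finset (Fin k)) (c : ℝ) : Prop :=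
  ∀ u v, Junta S u → Junta T v →
    |inner' μ u v - inner' μ (Aop μ (S ∩ T) u) v| ≤ c * (l2norm μ u * l2norm μ v)

theorem SwapBound.symm {c : ℝ} (h : SwapBound μ S T c) : SwapBound μ T S c := by
  intro u v hu hv
  have := h v u hv hu
  rwa [inner_Aop_left, inter_comm S T, mul_comm (l2norm μ v), inner_comm,
    inner_comm (f := v)] at this

theorem swapBound_of_subset (hμ : ∀ x, 0 ≤ μ x) {c : ℝ} (hc : 0 ≤ c) (h : S ⊆ T) :
    SwapBound μ S T c := by
  intro u v hu _
  rw [inter_eq_left.2 h, inner_Aop_left, inner_comm (f := u) (g := Aop μ S v),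
    inner_Aop_of_junta hμ hu, inner_comm, sub_self, abs_zero]
  exact mul_nonneg hc (mul_nonneg l2norm_nonneg l2norm_nonneg)

theorem SwapBound.step (hμ : ∀ x, 0 ≤ μ x) {i : Fin k} (hiS : i ∉ S) (hiT : i ∈ T)
    {c₁ c₂ : ℝ} (hc₂ : 0 ≤ c₂) (h₁ : SwapBound μ (insert i S) T c₁)
    (h₂ : SwapBound μ S (insert i (S ∩ T)) c₂) : SwapBound μ S T (c₁ + c₂) := by
  intro u v hu hv
  have e₁ := h₁ u v (hu.mono (subset_insert i S)) hv
  have e₂ := h₂ u (Aop μ (insert i (S ∩ T)) v) hu junta_Aop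
  rw [insert_inter_of_mem hiT, inner_Aop_left] at e₁
  have hS : S ∩ insert i (S ∩ T) = S ∩ T := by
    rw [inter_insert_of_notMem hiS, ← inter_assoc, inter_self]
  have hJ : inner' μ (Aop μ (S ∩ T) u) (Aop μ (insert i (S ∩ T)) v) =
      inner' μ (Aop μ (S ∩ T) u) v := by
    rw [inner_comm, inner_Aop_of_junta hμ (junta_Aop.mono (subset_insert _ _)), inner_comm]
  rw [hS, hJ] at e₂
  have e₃ : c₂ * (l2norm μ u * l2norm μ (Aop μ (insert i (S ∩ T)) v)) ≤
      c₂ * (l2norm μ u * l2norm μ v) := by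
    gcongr
    exacts [l2norm_nonneg, l2norm_Aop_le hμ]
  rw [add_mul]
  exact (abs_sub_le _ _ _).trans (add_le_add e₁ (e₂.trans e₃))

theorem sum_mul_sqrt_le (hμ : ∀ x, 0 ≤ μ x) (hf : ∀ x, 0 ≤ f x) (hg : ∀ x, 0 ≤ g x) :
    ∑ x, μ x * Real.sqrt (f x * g x) ≤
      Real.sqrt (∑ x, μ x * f x) * Real.sqrt (∑ x, μ x * g x) := by
  rw [← Real.sqrt_mul (sum_nonneg fun x _ => mul_nonneg (hμ x) (hf x))]
  refine Real.le_sqrt_of_sq_le (sum_sq_le_sum_mul_sum_of_sq_le_mul _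
    (fun x _ => mul_nonneg (hμ x) (hf x)) (fun x _ => mul_nonneg (hμ x) (hg x)) fun x _ => ?_)
  rw [mul_pow, Real.sq_sqrt (mul_nonneg (hf x) (hg x))]
  ring_nf
  rfl

theorem sum_mul_Aop_sq (hμ : ∀ x, 0 ≤ μ x) :
    ∑ x, μ x * Aop μ S (fun z => u z ^ 2) x = normSq μ u := by
  have := inner_Aop_of_junta (S := S) (f := fun z => u z ^ 2) (g := fun _ => 1) hμ
    fun _ _ _ => rfl
  rw [normSq_eq_inner_one, ← this]
  simp [inner']

theorem swapBound_of_pair (hμ : ∀ x, 0 ≤ μ x) {ε : ℝ} (hε : 0 ≤ ε) (hprod : EpsProduct μ ε)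
    {i j : Fin k} (hij : i ≠ j) {I : Finset (Fin k)} (hi : i ∉ I) (hj : j ∉ I) :
    SwapBound μ (insert i I) (insert j I) ε := by
  intro u v hu hv
  have hinter : insert i I ∩ insert j I = I := by
    ext a
    simp only [mem_inter, mem_insert]
    constructor
    · rintro ⟨rfl | h, rfl | h'⟩ <;> simp_all
    · exact fun h => ⟨Or.inr h, Or.inr h⟩
  have hcard : I.card ≤ k - 2 := by
    have h := card_le_univ (insert i (insert j I))
    rw [card_insert_of_notMem (by simp [hij, hi]), card_insert_of_notMem hj,
      Fintype.card_fin] at h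
    omega
  have hvar : ∀ (w : (∀ i, V i) → ℝ) x, 0 ≤ Aop μ I (fun z => w z ^ 2) x - Aop μ I w x ^ 2 :=
    fun w x => sub_nonneg.2 (sq_Aop_le hμ)
  have key : ∀ x, 0 < μ x → |Aop μ I (fun z => u z * v z) x - Aop μ I u x * Aop μ I v x| ≤
      ε * Real.sqrt (Aop μ I (fun z => u z ^ 2) x * Aop μ I (fun z => v z ^ 2) x) := by
    intro x hx
    have hfib : ∀ F G : (∀ i, V i) → ℝ, (∀ z, (∀ a ∈ I, z a = x a) → F z = G z) →
        expect (cond μ I x) F = Aop μ I G x := by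
      intro F G h
      refine sum_congr rfl fun z _ => ?_
      unfold cond
      split_ifs with hz
      · rw [h z hz]
      · simp
    have hupd : ∀ (w : (∀ i, V i) → ℝ) (b : Fin k), Junta (insert b I) w → b ∉ I →
        ∀ z, (∀ a ∈ I, z a = x a) → w (Function.update x b (z b)) = w z := by
      intro w b hw hb z hz
      refine hw _ _ fun a ha => ?_
      rcases mem_insert.1 ha with rfl | ha
      · simp
      · rw [Function.update_of_ne (ne_of_mem_of_not_mem ha hb), hz a ha]
    have hu' := hupd u i hu hi
    have hv' := hupd v j hv hj
    have h := hprod I hcard x (marg_pos hμ hx) i j hi hj hij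
      (fun a => u (Function.update x i a)) (fun a => v (Function.update x j a))
    rw [hfib _ (fun z => u z * v z) fun z hz => by rw [hu' z hz, hv' z hz],
      hfib _ u fun z hz => hu' z hz, hfib _ v fun z hz => hv' z hz,
      hfib _ (fun z => u z ^ 2) fun z hz => by rw [hu' z hz],
      hfib _ (fun z => v z ^ 2) fun z hz => by rw [hv' z hz]] at h
    refine h.trans (mul_le_mul_of_nonneg_left (Real.sqrt_le_sqrt ?_) hε)
    refine mul_le_mul ?_ ?_ (hvar v x) (Aop_nonneg hμ fun _ => sq_nonneg _)
    · exact sub_le_self _ (sq_nonneg _)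
    · exact sub_le_self _ (sq_nonneg _)
  have h₁ : inner' μ u v = ∑ x, μ x * Aop μ I (fun z => u z * v z) x := by
    have := inner_Aop_of_junta (S := I) (f := fun z => u z * v z) (g := fun _ => 1) hμ
      fun _ _ _ => rfl
    simpa [inner'] using this.symm
  have h₂ : inner' μ (Aop μ I u) v = ∑ x, μ x * (Aop μ I u x * Aop μ I v x) := by
    rw [inner_comm, ← inner_Aop_of_junta hμ junta_Aop, inner_comm]
    rfl
  rw [hinter, h₁, h₂, ← sum_sub_distrib]
  calc |∑ x, (μ x * Aop μ I (fun z => u z * v z) x - μ x * (Aop μ I u x * Aop μ I v x))|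
      ≤ ∑ x, μ x * (ε * Real.sqrt
          (Aop μ I (fun z => u z ^ 2) x * Aop μ I (fun z => v z ^ 2) x)) := by
        refine (abs_sum_le_sum_abs _ _).trans (sum_le_sum fun x _ => ?_)
        rw [← mul_sub, abs_mul, abs_of_nonneg (hμ x)]
        rcases (hμ x).eq_or_lt with hx | hx
        · simp [← hx]
        · exact mul_le_mul_of_nonneg_left (key x hx) (hμ x)
    _ = ε * ∑ x, μ x * Real.sqrt
          (Aop μ I (fun z => u z ^ 2) x * Aop μ I (fun z => v z ^ 2) x) := by
        rw [mul_sum]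
        exact sum_congr rfl fun x _ => by ring
    _ ≤ ε * (l2norm μ u * l2norm μ v) := by
        refine mul_le_mul_of_nonneg_left ?_ hε
        refine (sum_mul_sqrt_le hμ (fun x => Aop_nonneg hμ fun _ => sq_nonneg _)
          fun x => Aop_nonneg hμ fun _ => sq_nonneg _).trans_eq ?_
        rw [sum_mul_Aop_sq hμ, sum_mul_Aop_sq hμ, l2norm, l2norm]

theorem insert_inter_of_sdiff_eq_singleton {i : Fin k} (h : S \ T = {i}) :
    insert i (S ∩ T) = S := by
  rw [insert_eq, ← h, sdiff_union_inter]

theorem swapBound_card (hμ : ∀ x, 0 ≤ μ x) {ε : ℝ} (hε : 0 ≤ ε) (hprod : EpsProduct μ ε)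
    (S T : Finset (Fin k)) : SwapBound μ S T ((S \ T).card * (T \ S).card * ε) := by
  induction hn : (S \ T).card + (T \ S).card using Nat.strong_induction_on generalizing S T with
  | _ n ih =>
  subst hn
  have key : ∀ S' T' : Finset (Fin k), (S' \ T').Nonempty → 2 ≤ (T' \ S').card →
      (S' \ T').card + (T' \ S').card = (S \ T).card + (T \ S).card →
      SwapBound μ S' T' ((S' \ T').card * (T' \ S').card * ε) := by
    intro S' T' hS' hT' hcard
    obtain ⟨i, hi⟩ : (T' \ S').Nonempty := card_pos.1 (by omega)
    have hi' := mem_sdiff.1 hi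
    have s₁ : insert i S' \ T' = S' \ T' := insert_sdiff_of_mem _ hi'.1
    have s₂ : (T' \ insert i S').card = (T' \ S').card - 1 := by
      rw [sdiff_insert, card_erase_of_mem hi]
    have s₃ : S' \ insert i (S' ∩ T') = S' \ T' := by
      rw [sdiff_insert_of_notMem hi'.2, sdiff_inter_self_left]
    have s₄ : insert i (S' ∩ T') \ S' = {i} := by
      rw [insert_sdiff_of_notMem _ hi'.2, sdiff_eq_empty_iff_subset.2 inter_subset_left]
      rfl
    have h₁ := ih _ (by rw [s₁, s₂]; omega) (insert i S') T' rfl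
    have h₂ := ih _ (by rw [s₃, s₄, card_singleton]; omega) S' (insert i (S' ∩ T')) rfl
    rw [s₁, s₂] at h₁
    rw [s₃, s₄] at h₂
    have h := SwapBound.step hμ hi'.2 hi'.1 (by positivity) h₁ h₂
    convert h using 1
    rw [card_singleton, Nat.cast_sub (by omega)]
    push_cast
    ring
  rcases (S \ T).eq_empty_or_nonempty with hS | hS
  · exact swapBound_of_subset hμ (by positivity) (sdiff_eq_empty_iff_subset.1 hS)
  rcases (T \ S).eq_empty_or_nonempty with hT | hT
  · exact (swapBound_of_subset hμ (by positivity) (sdiff_eq_empty_iff_subset.1 hT)).symm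
  by_cases hT2 : 2 ≤ (T \ S).card
  · exact key S T hS hT2 rfl
  by_cases hS2 : 2 ≤ (S \ T).card
  · have := (key T S hT hS2 (add_comm _ _)).symm
    rwa [mul_comm ((T \ S).card : ℝ)] at this
  have hS1 : (S \ T).card = 1 := by have := card_pos.2 hS; omega
  have hT1 : (T \ S).card = 1 := by have := card_pos.2 hT; omega
  obtain ⟨i, hi⟩ := card_eq_one.1 hS1
  obtain ⟨j, hj⟩ := card_eq_one.1 hT1
  have hiS : i ∈ S \ T := hi ▸ mem_singleton_self i
  have hjT : j ∈ T \ S := hj ▸ mem_singleton_self j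
  rw [mem_sdiff] at hiS hjT
  have h := swapBound_of_pair (I := S ∩ T) hμ hε hprod
    (fun h : i = j => hiS.2 (h ▸ hjT.1)) (fun h => hiS.2 (mem_inter.1 h).2)
    (fun h => hjT.2 (mem_inter.1 h).1)
  rw [insert_inter_of_sdiff_eq_singleton hi, inter_comm,
    insert_inter_of_sdiff_eq_singleton hj] at h
  simpa [hS1, hT1] using h

theorem swapBound (hμ : ∀ x, 0 ≤ μ x) {ε : ℝ} (hε : 0 ≤ ε) (hprod : EpsProduct μ ε)
    (S T : Finset (Fin k)) : SwapBound μ S T ((k : ℝ) ^ 2 * ε) := by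
  intro u v hu hv
  refine (swapBound_card hμ hε hprod S T u v hu hv).trans ?_
  have hS : ((S \ T).card : ℝ) ≤ k := by exact_mod_cast card_finset_fin_le _
  have hT : ((T \ S).card : ℝ) ≤ k := by exact_mod_cast card_finset_fin_le _
  refine mul_le_mul_of_nonneg_right ?_ (mul_nonneg l2norm_nonneg l2norm_nonneg)
  rw [sq]
  gcongr

theorem abs_inner_Aop_sub_le (hμ : ∀ x, 0 ≤ μ x) {ε : ℝ} (hε : 0 ≤ ε)
    (hprod : EpsProduct μ ε) (S : Finset (Fin k)) (hv : Junta T v) :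
    |inner' μ (Aop μ S u) v - inner' μ (Aop μ (S ∩ T) u) v| ≤
      (k : ℝ) ^ 2 * ε * (l2norm μ u * l2norm μ v) := by
  have h := swapBound hμ hε hprod S T (Aop μ S u) v junta_Aop hv
  rw [inner_Aop_Aop_of_subset hμ inter_subset_left] at h
  refine h.trans ?_
  gcongr
  exacts [l2norm_nonneg, l2norm_Aop_le hμ]

/-- The Efron–Stein component relative to a set `B` of frozen coordinates. -/
noncomputable def relES (μ : (∀ i, V i) → ℝ) (B U : Finset (Fin k)) (f : (∀ i, V i) → ℝ)
    (x : ∀ i, V i) : ℝ :=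
  ∑ W ∈ U.powerset, (-1 : ℝ) ^ (U.card - W.card) * Aop μ (B ∪ W) f x

variable {B U : Finset (Fin k)}

theorem relES_empty_left : relES μ ∅ U f = ES μ U f := by
  funext x
  simp [relES, ES]

theorem relES_empty_right : relES μ B ∅ f = Aop μ B f := by
  funext x
  simp [relES]

theorem relES_insert {i : Fin k} (hi : i ∉ U) :
    relES μ B (insert i U) f x = relES μ (insert i B) U f x - relES μ B U f x := by
  unfold relES
  rw [sum_powerset_insert hi, add_comm, sub_eq_add_neg, ← sum_neg_distrib]
  congr 1
  · refine sum_congr rfl fun W hW => ?_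
    have hiW : i ∉ W := fun h => hi (mem_powerset.1 hW h)
    rw [card_insert_of_notMem hi, card_insert_of_notMem hiW, Nat.add_sub_add_right,
      union_insert, insert_union]
  · refine sum_congr rfl fun W hW => ?_
    have hWU := card_le_card (mem_powerset.1 hW)
    rw [card_insert_of_notMem hi, Nat.sub_add_comm hWU, pow_succ]
    ring

theorem sum_relES (Y : Finset (Fin k)) :
    ∑ U ∈ Y.powerset, relES μ B U f x = Aop μ (B ∪ Y) f x := by
  induction Y using Finset.induction_on generalizing B with
  | empty => simp [relES_empty_right]
  | insert i Y hi ih =>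
    rw [sum_powerset_insert hi]
    have : ∀ U ∈ Y.powerset, relES μ B (insert i U) f x =
        relES μ (insert i B) U f x - relES μ B U f x := fun U hU =>
      relES_insert fun h => hi (mem_powerset.1 hU h)
    rw [sum_congr rfl this, sum_sub_distrib, ih, ih, union_insert, insert_union]
    ring

theorem relES_union_sq_le {J : Finset (Fin k)} (h : Disjoint J U) :
    relES μ B (J ∪ U) f x ^ 2 ≤
      2 ^ J.card * ∑ J' ∈ J.powerset, relES μ (B ∪ J') U f x ^ 2 := by
  induction J using Finset.induction_on generalizing B with
  | empty => simp
  | insert i J hi ih =>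
    rw [disjoint_insert_left] at h
    rw [insert_union, relES_insert (by simp [hi, h.1]), sum_powerset_insert hi,
      card_insert_of_notMem hi]
    have h₁ := ih (B := B) h.2
    have h₂ := ih (B := insert i B) h.2
    simp only [union_insert, insert_union] at h₂ ⊢
    rw [pow_succ (2 : ℝ)]
    nlinarith [sq_nonneg (relES μ (insert i B) (J ∪ U) f x + relES μ B (J ∪ U) f x)]

theorem junta_relES : Junta (B ∪ U) (relES μ B U f) := by
  intro x y h
  unfold relES
  refine sum_congr rfl fun W hW => ?_
  rw [junta_Aop.mono (union_subset_union_right (mem_powerset.1 hW)) x y h]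

theorem two_pow_card_le (S : Finset (Fin k)) : (2 : ℝ) ^ S.card ≤ 2 ^ k :=
  pow_le_pow_right₀ one_le_two (card_finset_fin_le S)

theorem abs_relES_le {b : ℝ} (h : ∀ W ⊆ U, |Aop μ (B ∪ W) f x| ≤ b) :
    |relES μ B U f x| ≤ 2 ^ k * b := by
  have hb : 0 ≤ b := (abs_nonneg _).trans (h ∅ (empty_subset U))
  calc |relES μ B U f x| ≤ ∑ W ∈ U.powerset, b := by
        refine (abs_sum_le_sum_abs _ _).trans (sum_le_sum fun W hW => ?_)
        rw [abs_mul, abs_pow, abs_neg, abs_one, one_pow, one_mul]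
        exact h W (mem_powerset.1 hW)
    _ ≤ 2 ^ k * b := by
        rw [sum_const, card_powerset, nsmul_eq_mul]
        push_cast
        exact mul_le_mul_of_nonneg_right (two_pow_card_le U) hb

theorem normSq_relES_le (hμ : ∀ x, 0 ≤ μ x) :
    normSq μ (relES μ B U f) ≤ (2 ^ k) ^ 2 * normSq μ f := by
  calc normSq μ (relES μ B U f)
      ≤ ∑ x, μ x * (2 ^ U.card * ∑ W ∈ U.powerset, Aop μ (B ∪ W) f x ^ 2) := by
        refine sum_le_sum fun x _ => mul_le_mul_of_nonneg_left ?_ (hμ x)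
        have h := sq_sum_le_card_mul_sum_sq (s := U.powerset)
          (f := fun W => (-1 : ℝ) ^ (U.card - W.card) * Aop μ (B ∪ W) f x)
        simpa [relES, mul_pow, ← pow_mul, mul_comm _ 2, card_powerset] using h
    _ = 2 ^ U.card * ∑ W ∈ U.powerset, normSq μ (Aop μ (B ∪ W) f) := by
        simp only [normSq, mul_sum]
        rw [sum_comm]
        exact sum_congr rfl fun _ _ => sum_congr rfl fun _ _ => by ring
    _ ≤ 2 ^ U.card * ∑ W ∈ U.powerset, normSq μ f := by
        gcongr
        exact normSq_Aop_le hμ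
    _ = (2 ^ U.card) ^ 2 * normSq μ f := by
        rw [sum_const, card_powerset, nsmul_eq_mul]
        push_cast
        ring
    _ ≤ (2 ^ k) ^ 2 * normSq μ f := by
        refine mul_le_mul_of_nonneg_right ?_ (normSq_nonneg hμ)
        exact pow_le_pow_left₀ (by positivity) (two_pow_card_le U) 2

theorem l2norm_relES_le (hμ : ∀ x, 0 ≤ μ x) :
    l2norm μ (relES μ B U f) ≤ 2 ^ k * l2norm μ f :=
  l2norm_le_of_normSq_le hμ (by positivity) (normSq_relES_le hμ)

theorem relES_mul_junta (hφ : Junta B φ) :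
    relES μ B U (fun x => φ x * f x) x = φ x * relES μ B U f x := by
  simp only [relES, mul_sum]
  refine sum_congr rfl fun W _ => ?_
  rw [Aop_mul_junta (hφ.mono subset_union_left)]
  ring

theorem inner_relES_left :
    inner' μ (relES μ B U f) g =
      ∑ W ∈ U.powerset, (-1 : ℝ) ^ (U.card - W.card) * inner' μ (Aop μ (B ∪ W) f) g := by
  unfold relES
  rw [inner_sum_left]
  exact sum_congr rfl fun W _ => inner_const_mul_left _

theorem abs_inner_relES_le (hμ : ∀ x, 0 ≤ μ x) {ε : ℝ} (hε : 0 ≤ ε) (hprod : EpsProduct μ ε)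
    (hv : Junta T v) (hB : Disjoint B U) (hUT : ¬ U ⊆ T) :
    |inner' μ (relES μ B U f) v| ≤
      2 ^ k * ((k : ℝ) ^ 2 * ε * (l2norm μ f * l2norm μ v)) := by
  obtain ⟨i, hiU, hiT⟩ := not_subset.1 hUT
  have hzero : ∑ W ∈ U.powerset, (-1 : ℝ) ^ (U.card - W.card) *
      inner' μ (Aop μ ((B ∪ W) ∩ T) f) v = 0 := by
    obtain ⟨U', hi, rfl⟩ : ∃ U', i ∉ U' ∧ insert i U' = U :=
      ⟨U.erase i, notMem_erase i U, insert_erase hiU⟩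
    rw [sum_powerset_insert hi, ← sum_add_distrib]
    refine sum_eq_zero fun W hW => ?_
    have hiW : i ∉ W := fun h => hi (mem_powerset.1 hW h)
    have hWU := card_le_card (mem_powerset.1 hW)
    rw [card_insert_of_notMem hi, card_insert_of_notMem hiW, Nat.add_sub_add_right,
      Nat.sub_add_comm hWU, union_insert, insert_inter_of_notMem hiT, pow_succ]
    ring
  rw [inner_relES_left, ← sub_zero (∑ W ∈ U.powerset, _), ← hzero]
  refine (abs_sum_sub_sum_le U.powerset (c := (k : ℝ) ^ 2 * ε * (l2norm μ f * l2norm μ v))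
    fun W _ => ?_).trans ?_
  · rw [← mul_sub, abs_mul, abs_pow, abs_neg, abs_one, one_pow, one_mul]
    exact abs_inner_Aop_sub_le hμ hε hprod _ hv
  · rw [card_powerset]
    push_cast
    refine mul_le_mul_of_nonneg_right (two_pow_card_le U) ?_
    have := l2norm_nonneg (μ := μ) (f := f)
    have := l2norm_nonneg (μ := μ) (f := v)
    positivity

theorem abs_inner_relES_self_sub_le (hμ : ∀ x, 0 ≤ μ x) {ε : ℝ} (hε : 0 ≤ ε)
    (hprod : EpsProduct μ ε) (hB : Disjoint B U) :
    |inner' μ (relES μ B U f) (relES μ B U f) - inner' μ (relES μ B U f) f| ≤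
      4 ^ k * ((k : ℝ) ^ 2 * ε * normSq μ f) := by
  have hsum : inner' μ (relES μ B U f) f =
      ∑ W ∈ U.powerset, if W = U then inner' μ (relES μ B U f) f else 0 := by
    simp
  rw [hsum, inner_relES_left (g := relES μ B U f)]
  refine (abs_sum_sub_sum_le U.powerset
    (c := 2 ^ k * ((k : ℝ) ^ 2 * ε * normSq μ f)) fun W hW => ?_).trans ?_
  · split_ifs with h
    · subst h
      rw [inner_Aop_of_junta hμ junta_relES, Nat.sub_self, pow_zero, one_mul, inner_comm,
        sub_self, abs_zero]
      have := normSq_nonneg (f := f) hμ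
      positivity
    · have hUW : ¬ U ⊆ B ∪ W := fun hU =>
        h ((mem_powerset.1 hW).antisymm (hB.symm.left_le_of_le_sup_left hU))
      have := abs_inner_relES_le (f := f) hμ hε hprod (junta_Aop (μ := μ) (f := f)) hB hUW
      rw [sub_zero, abs_mul, abs_pow, abs_neg, abs_one, one_pow, one_mul, inner_comm]
      refine this.trans ?_
      rw [← l2norm_sq hμ, sq (l2norm μ f)]
      gcongr
      exacts [l2norm_nonneg, l2norm_Aop_le hμ]
  · rw [card_powerset]
    have := normSq_nonneg (f := f) hμ
    push_cast
    rw [show (4 : ℝ) = 2 * 2 by norm_num, mul_pow, mul_assoc ((2 : ℝ) ^ k)]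
    exact mul_le_mul_of_nonneg_right (two_pow_card_le U) (by positivity)

theorem card_finset_le (s : Finset (Finset (Fin k))) : (s.card : ℝ) ≤ 2 ^ k := by
  have := card_le_univ s
  rw [Fintype.card_finset, Fintype.card_fin] at this
  exact_mod_cast this

/-- An approximate Bessel inequality. -/
theorem sum_normSq_relES_le (hμ : ∀ x, 0 ≤ μ x) {ε : ℝ} (hε : 0 ≤ ε)
    (hprod : EpsProduct μ ε) (B : Finset (Fin k)) :
    ∑ U ∈ Bᶜ.powerset, normSq μ (relES μ B U f) ≤
      (1 + 8 ^ k * ((k : ℝ) ^ 2 * ε)) * normSq μ f := by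
  have h₁ : ∑ U ∈ Bᶜ.powerset, inner' μ (relES μ B U f) f = normSq μ f := by
    rw [← inner_sum_left]
    simp only [sum_relES, union_compl]
    rw [inner_Aop_of_junta hμ (fun x y h => by rw [funext fun i => h i (mem_univ i)]),
      normSq_eq_inner]
  have h₂ := abs_sum_sub_sum_le Bᶜ.powerset
    (a := fun U => inner' μ (relES μ B U f) (relES μ B U f))
    (b := fun U => inner' μ (relES μ B U f) f) fun U hU =>
      abs_inner_relES_self_sub_le (f := f) hμ hε hprod
        (disjoint_compl_right.mono_right (mem_powerset.1 hU))
  rw [h₁] at h₂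
  have h₃ := (abs_le.1 h₂).2
  have h₄ : ((Bᶜ.powerset).card : ℝ) * (4 ^ k * ((k : ℝ) ^ 2 * ε * normSq μ f)) ≤
      2 ^ k * (4 ^ k * ((k : ℝ) ^ 2 * ε * normSq μ f)) := by
    have := normSq_nonneg (f := f) hμ
    exact mul_le_mul_of_nonneg_right (card_finset_le _) (by positivity)
  have h₅ : (2 : ℝ) ^ k * 4 ^ k = 8 ^ k := by
    rw [← mul_pow]
    norm_num
  simp only [← normSq_eq_inner] at h₃
  rw [← h₅]
  linarith

/-- Cauchy–Schwarz over the pairs of sets that agree off `S` and together cover `S`. -/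
theorem sq_sum_sqrt_le {d : ℕ} {𝒯 : Finset (Finset (Fin k))} (h𝒯 : ∀ T ∈ 𝒯, T.card ≤ d)
    {a : Finset (Fin k) → ℝ} (ha : ∀ T, 0 ≤ a T) (S : Finset (Fin k)) :
    (∑ q ∈ (𝒯 ×ˢ 𝒯) with q.1 \ S = q.2 \ S ∧ S ⊆ q.1 ∪ q.2, √(a q.1 * a q.2)) ^ 2 ≤
      16 ^ d * ∑ q ∈ (𝒯 ×ˢ 𝒯) with S ⊆ q.1 ∪ q.2, a q.1 * a q.2 := by
  set R := (𝒯 ×ˢ 𝒯).filter fun q => q.1 \ S = q.2 \ S ∧ S ⊆ q.1 ∪ q.2 with hR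
  set R' := (𝒯 ×ˢ 𝒯).filter fun q => S ⊆ q.1 ∪ q.2 with hR'
  have hR'0 : 0 ≤ ∑ q ∈ R', a q.1 * a q.2 := sum_nonneg fun q _ => mul_nonneg (ha _) (ha _)
  rcases R.eq_empty_or_nonempty with h0 | ⟨q₀, hq₀⟩
  · rw [h0, sum_empty, zero_pow two_ne_zero]
    positivity
  have hS : S.card ≤ 2 * d := by
    simp only [hR, mem_filter, mem_product] at hq₀
    have h₁ := card_le_card hq₀.2.2
    have h₂ := card_union_le q₀.1 q₀.2
    have h₃ := h𝒯 _ hq₀.1.1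
    have h₄ := h𝒯 _ hq₀.1.2
    omega
  set Q := S.powerset ×ˢ S.powerset with hQ
  set tr : Finset (Fin k) × Finset (Fin k) → Finset (Fin k) × Finset (Fin k) :=
    fun q => (q.1 ∩ S, q.2 ∩ S) with htr
  have hmaps : ∀ q, tr q ∈ Q := fun q => by
    simp only [hQ, htr, mem_product, mem_powerset]
    exact ⟨inter_subset_right, inter_subset_right⟩
  have hcard : (Q.card : ℝ) ≤ 16 ^ d := by
    rw [hQ, card_product, card_powerset]
    push_cast
    rw [← pow_add, show (16 : ℝ) ^ d = 2 ^ (2 * d + 2 * d) by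
      rw [show (16 : ℝ) = 2 ^ 4 by norm_num, ← pow_mul]; congr 1; ring]
    exact pow_le_pow_right₀ one_le_two (by omega)
  have hfib : ∀ p ∈ Q, (∑ q ∈ R with tr q = p, √(a q.1 * a q.2)) ^ 2 ≤
      ∑ q ∈ R' with tr q = p, a q.1 * a q.2 := by
    intro p _
    refine (sum_sq_le_sum_mul_sum_of_sq_le_mul _
      (f := fun q : Finset (Fin k) × Finset (Fin k) => a q.1)
      (g := fun q : Finset (Fin k) × Finset (Fin k) => a q.2)
      (fun q _ => ha _) (fun q _ => ha _)
      fun q _ => (Real.sq_sqrt (mul_nonneg (ha _) (ha _))).le).trans ?_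
    rw [sum_mul_sum, ← sum_product']
    set m : (Finset (Fin k) × Finset (Fin k)) × (Finset (Fin k) × Finset (Fin k)) →
      Finset (Fin k) × Finset (Fin k) := fun r => (r.1.1, r.2.2) with hm
    have hinj : Set.InjOn m ((R.filter fun q => tr q = p) ×ˢ (R.filter fun q => tr q = p) :
        Finset _) := by
      rintro ⟨⟨x₁, x₂⟩, ⟨x₃, x₄⟩⟩ hx ⟨⟨y₁, y₂⟩, ⟨y₃, y₄⟩⟩ hy hxy
      simp only [coe_product, Set.mem_prod, mem_coe, mem_filter, hR, htr, Prod.ext_iff] at hx hy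
      simp only [hm, Prod.mk.injEq] at hxy
      obtain ⟨rfl, rfl⟩ := hxy
      have e₁ : x₂ = y₂ := by
        rw [← sdiff_union_inter x₂ S, ← sdiff_union_inter y₂ S, ← hx.1.1.2.1, ← hy.1.1.2.1,
          hx.1.2.2, hy.1.2.2]
      have e₂ : x₃ = y₃ := by
        rw [← sdiff_union_inter x₃ S, ← sdiff_union_inter y₃ S, hx.2.1.2.1, hy.2.1.2.1,
          hx.2.2.1, hy.2.2.1]
      rw [e₁, e₂]
    rw [← sum_image (f := fun q : Finset (Fin k) × Finset (Fin k) => a q.1 * a q.2) hinj]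
    refine sum_le_sum_of_subset_of_nonneg ?_ fun q _ _ => mul_nonneg (ha _) (ha _)
    intro q hq
    obtain ⟨⟨⟨x₁, x₂⟩, ⟨x₃, x₄⟩⟩, hx, rfl⟩ := mem_image.1 hq
    simp only [mem_product, mem_filter, hR, htr, Prod.ext_iff] at hx
    simp only [hm, hR', htr, mem_filter, mem_product, Prod.ext_iff]
    refine ⟨⟨⟨hx.1.1.1.1, hx.2.1.1.2⟩, ?_⟩, hx.1.2.1, hx.2.2.2⟩
    intro i hi
    have h₁ := hx.1.1.2.2 hi
    have h₂ : i ∈ x₂ ∩ S ↔ i ∈ x₄ ∩ S := by rw [hx.1.2.2, hx.2.2.2]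
    simp only [mem_inter, mem_union, hi, and_true] at h₁ h₂ ⊢
    rwa [← h₂]
  calc (∑ q ∈ R, √(a q.1 * a q.2)) ^ 2
      = (∑ p ∈ Q, ∑ q ∈ R with tr q = p, √(a q.1 * a q.2)) ^ 2 := by
        rw [sum_fiberwise_of_maps_to fun q _ => hmaps q]
    _ ≤ Q.card * ∑ p ∈ Q, (∑ q ∈ R with tr q = p, √(a q.1 * a q.2)) ^ 2 :=
        sq_sum_le_card_mul_sum_sq
    _ ≤ Q.card * ∑ p ∈ Q, ∑ q ∈ R' with tr q = p, a q.1 * a q.2 :=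
        mul_le_mul_of_nonneg_left (sum_le_sum hfib) (Nat.cast_nonneg _)
    _ = Q.card * ∑ q ∈ R', a q.1 * a q.2 := by
        rw [sum_fiberwise_of_maps_to fun q _ => hmaps q]
    _ ≤ 16 ^ d * ∑ q ∈ R', a q.1 * a q.2 := mul_le_mul_of_nonneg_right hcard hR'0

theorem normSq_mul_le (hμ : ∀ x, 0 ≤ μ x) {b : ℝ} (hg : ∀ x, |g x| ≤ b) :
    normSq μ (fun x => f x * g x) ≤ b ^ 2 * normSq μ f := by
  rw [← normSq_const_mul]
  refine normSq_mono hμ fun x => ?_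
  rw [abs_mul, abs_mul, mul_comm]
  exact mul_le_mul_of_nonneg_right ((hg x).trans (le_abs_self b)) (abs_nonneg _)

theorem abs_ES_le (hμ : ∀ x, 0 ≤ μ x) (hf : ∀ x, |f x| ≤ 1) : |relES μ B U f x| ≤ 2 ^ k := by
  simpa using abs_relES_le (B := B) (U := U) (x := x)
    fun W _ => abs_Aop_le (S := B ∪ W) (x := x) hμ zero_le_one hf

theorem l2norm_relES_mul_le (hμ : ∀ x, 0 ≤ μ x) (hf : ∀ x, |f x| ≤ 1)
    {B' U' : Finset (Fin k)} :
    l2norm μ (fun x => relES μ B U f x * relES μ B' U' f x) ≤ (2 ^ k) ^ 2 * l2norm μ f := by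
  refine l2norm_le_of_normSq_le hμ (by positivity) ?_
  refine (normSq_mul_le hμ fun x => abs_ES_le hμ hf).trans ?_
  calc ((2 : ℝ) ^ k) ^ 2 * normSq μ (relES μ B U f)
      ≤ (2 ^ k) ^ 2 * ((2 ^ k) ^ 2 * normSq μ f) := by
        gcongr
        exact normSq_relES_le hμ
    _ = _ := by ring

theorem l2norm_mul_le (hμ : ∀ x, 0 ≤ μ x) {a b : ℝ} (ha : 0 ≤ a)
    (hu : l2norm μ u ≤ a * l2norm μ f) (hv : l2norm μ v ≤ b * l2norm μ f) :
    l2norm μ u * l2norm μ v ≤ a * b * normSq μ f := by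
  calc l2norm μ u * l2norm μ v ≤ (a * l2norm μ f) * (b * l2norm μ f) :=
        mul_le_mul hu hv l2norm_nonneg (mul_nonneg ha l2norm_nonneg)
    _ = a * b * normSq μ f := by
        rw [← l2norm_sq hμ]
        ring

theorem abs_inner_ES_quadruple_le (hμ : ∀ x, 0 ≤ μ x) {ε : ℝ} (hε : 0 ≤ ε)
    (hprod : EpsProduct μ ε) (hf : ∀ x, |f x| ≤ 1) {T₁ T₂ T₃ T₄ : Finset (Fin k)}
    (h : ¬ T₁ ⊆ T₂ ∪ (T₃ ∪ T₄)) :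
    |inner' μ (relES μ ∅ T₁ f)
        (fun x => relES μ ∅ T₂ f x * (relES μ ∅ T₃ f x * relES μ ∅ T₄ f x))| ≤
      (2 ^ k) ^ 4 * ((k : ℝ) ^ 2 * ε * normSq μ f) := by
  have hj : ∀ T, Junta T (relES μ ∅ T f) := fun T => by
    simpa using junta_relES (μ := μ) (B := ∅) (U := T) (f := f)
  have hv : l2norm μ (fun x => relES μ ∅ T₂ f x * (relES μ ∅ T₃ f x * relES μ ∅ T₄ f x)) ≤
      (2 ^ k) ^ 3 * l2norm μ f := by
    refine l2norm_le_of_normSq_le hμ (by positivity) ?_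
    refine (normSq_mul_le (b := 2 ^ k * 2 ^ k) hμ fun x => ?_).trans ?_
    · rw [abs_mul]
      gcongr <;> exact abs_ES_le hμ hf
    · calc ((2 : ℝ) ^ k * 2 ^ k) ^ 2 * normSq μ (relES μ ∅ T₂ f)
          ≤ (2 ^ k * 2 ^ k) ^ 2 * ((2 ^ k) ^ 2 * normSq μ f) := by
            gcongr
            exact normSq_relES_le hμ
        _ = _ := by ring
  refine (abs_inner_relES_le hμ hε hprod ((hj T₂).mul_union ((hj T₃).mul_union (hj T₄)))
    (disjoint_empty_left _) h).trans ?_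
  have := l2norm_mul_le (u := f) (a := 1) hμ zero_le_one (one_mul _).ge hv
  calc _ ≤ 2 ^ k * ((k : ℝ) ^ 2 * ε * (1 * (2 ^ k) ^ 3 * normSq μ f)) := by gcongr
    _ = _ := by ring

theorem junta_ES : Junta U (relES μ ∅ U f) := by
  simpa using junta_relES (μ := μ) (B := ∅) (U := U) (f := f)

/-- The products of two pairs of Efron–Stein components correlate only through the common
coordinates, and essentially only if no coordinate occurs exactly once. -/
theorem inner_ES_mul_le (hμ : ∀ x, 0 ≤ μ x) {ε : ℝ} (hε : 0 ≤ ε)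
    (hprod : EpsProduct μ ε) (hf : ∀ x, |f x| ≤ 1) (q r : Finset (Fin k) × Finset (Fin k)) :
    inner' μ (fun x => relES μ ∅ q.1 f x * relES μ ∅ q.2 f x)
        (fun x => relES μ ∅ r.1 f x * relES μ ∅ r.2 f x) ≤
      (∑ S : Finset (Fin k),
        if (q.1 \ S = q.2 \ S ∧ S ⊆ q.1 ∪ q.2) ∧ (r.1 \ S = r.2 \ S ∧ S ⊆ r.1 ∪ r.2) then
          ∑ x, μ x *
            (√(Aop μ S (fun z => relES μ ∅ q.1 f z ^ 2) x *
                Aop μ S (fun z => relES μ ∅ q.2 f z ^ 2) x) *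
              √(Aop μ S (fun z => relES μ ∅ r.1 f z ^ 2) x *
                Aop μ S (fun z => relES μ ∅ r.2 f z ^ 2) x))
        else 0) + (2 ^ k) ^ 4 * ((k : ℝ) ^ 2 * ε * normSq μ f) := by
  obtain ⟨T₁, T₂⟩ := q
  obtain ⟨T₃, T₄⟩ := r
  dsimp only
  set F : Finset (Fin k) → (∀ i, V i) → ℝ := fun T => relES μ ∅ T f with hF
  set S := (T₁ ∪ T₂) ∩ (T₃ ∪ T₄) with hS
  set s : Finset (Fin k) → ℝ := fun S =>
    if (T₁ \ S = T₂ \ S ∧ S ⊆ T₁ ∪ T₂) ∧ (T₃ \ S = T₄ \ S ∧ S ⊆ T₃ ∪ T₄) then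
      ∑ x, μ x * (√(Aop μ S (fun z => F T₁ z ^ 2) x * Aop μ S (fun z => F T₂ z ^ 2) x) *
        √(Aop μ S (fun z => F T₃ z ^ 2) x * Aop μ S (fun z => F T₄ z ^ 2) x))
    else 0 with hs
  have hs0 : ∀ S, 0 ≤ s S := fun S => by
    simp only [hs]
    split_ifs
    · exact sum_nonneg fun x _ => mul_nonneg (hμ x) (by positivity)
    · exact le_rfl
  change inner' μ (fun x => F T₁ x * F T₂ x) (fun x => F T₃ x * F T₄ x) ≤ ∑ S, s S + _
  have hbad : ∀ A₁ A₂ A₃ A₄, ¬ A₁ ⊆ A₂ ∪ (A₃ ∪ A₄) →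
      (∀ x, F T₁ x * F T₂ x * (F T₃ x * F T₄ x) = F A₁ x * (F A₂ x * (F A₃ x * F A₄ x))) →
      inner' μ (fun x => F T₁ x * F T₂ x) (fun x => F T₃ x * F T₄ x) ≤
        ∑ S, s S + (2 ^ k) ^ 4 * ((k : ℝ) ^ 2 * ε * normSq μ f) := by
    intro A₁ A₂ A₃ A₄ hA heq
    have h := (le_abs_self _).trans (abs_inner_ES_quadruple_le hμ hε hprod hf hA)
    have h' : inner' μ (fun x => F T₁ x * F T₂ x) (fun x => F T₃ x * F T₄ x) =
        inner' μ (relES μ ∅ A₁ f)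
          (fun x => relES μ ∅ A₂ f x * (relES μ ∅ A₃ f x * relES μ ∅ A₄ f x)) :=
      sum_congr rfl fun x _ => congrArg (μ x * ·) (heq x)
    have := sum_nonneg fun S (_ : S ∈ (univ : Finset (Finset (Fin k)))) => hs0 S
    linarith
  by_cases h₁ : T₁ ⊆ T₂ ∪ (T₃ ∪ T₄)
  swap
  · exact hbad _ _ _ _ h₁ fun x => by ring
  by_cases h₂ : T₂ ⊆ T₁ ∪ (T₃ ∪ T₄)
  swap
  · exact hbad _ _ _ _ h₂ fun x => by ring
  by_cases h₃ : T₃ ⊆ T₄ ∪ (T₁ ∪ T₂)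
  swap
  · exact hbad _ _ _ _ h₃ fun x => by ring
  by_cases h₄ : T₄ ⊆ T₃ ∪ (T₁ ∪ T₂)
  swap
  · exact hbad _ _ _ _ h₄ fun x => by ring
  have hlink : (T₁ \ S = T₂ \ S ∧ S ⊆ T₁ ∪ T₂) ∧ (T₃ \ S = T₄ \ S ∧ S ⊆ T₃ ∪ T₄) := by
    have hsub : ∀ {A B C : Finset (Fin k)}, A ⊆ B ∪ C → A \ ((A ∪ B) ∩ C) ⊆ B := by
      intro A B C h i hi
      simp only [mem_sdiff, mem_inter, mem_union, not_and] at hi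
      exact (mem_union.1 (h hi.1)).resolve_right (hi.2 (Or.inl hi.1))
    have e₁ := hsub h₁
    have e₂ := hsub h₂
    have e₃ := hsub h₃
    have e₄ := hsub h₄
    rw [union_comm T₂] at e₂
    rw [union_comm T₄, inter_comm] at e₄
    rw [inter_comm] at e₃
    exact ⟨⟨subset_antisymm (subset_sdiff.2 ⟨e₁, sdiff_disjoint⟩)
      (subset_sdiff.2 ⟨e₂, sdiff_disjoint⟩), inter_subset_left⟩,
      subset_antisymm (subset_sdiff.2 ⟨e₃, sdiff_disjoint⟩)
      (subset_sdiff.2 ⟨e₄, sdiff_disjoint⟩), inter_subset_right⟩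
  have hmain := abs_le.1 (swapBound hμ hε hprod (T₁ ∪ T₂) (T₃ ∪ T₄)
    (fun x => F T₁ x * F T₂ x) (fun x => F T₃ x * F T₄ x)
    (junta_ES.mul_union junta_ES) (junta_ES.mul_union junta_ES))
  have hnorm : l2norm μ (fun x => F T₁ x * F T₂ x) * l2norm μ (fun x => F T₃ x * F T₄ x) ≤
      (2 ^ k) ^ 2 * (2 ^ k) ^ 2 * normSq μ f :=
    l2norm_mul_le hμ (by positivity) (l2norm_relES_mul_le hμ hf) (l2norm_relES_mul_le hμ hf)
  have herr : (k : ℝ) ^ 2 * ε * (l2norm μ (fun x => F T₁ x * F T₂ x) *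
      l2norm μ (fun x => F T₃ x * F T₄ x)) ≤ (2 ^ k) ^ 4 * ((k : ℝ) ^ 2 * ε * normSq μ f) := by
    calc _ ≤ (k : ℝ) ^ 2 * ε * ((2 ^ k) ^ 2 * (2 ^ k) ^ 2 * normSq μ f) := by gcongr
      _ = _ := by ring
  have hAop : ∀ A B x, |Aop μ S (fun x => F A x * F B x) x| ≤
      √(Aop μ S (fun z => F A z ^ 2) x * Aop μ S (fun z => F B z ^ 2) x) := fun A B x =>
    Real.abs_le_sqrt (sq_Aop_mul_le hμ)
  have hgood : inner' μ (Aop μ S (fun x => F T₁ x * F T₂ x)) (fun x => F T₃ x * F T₄ x) ≤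
      s S := by
    rw [inner_comm, ← inner_Aop_of_junta hμ junta_Aop, hs]
    simp only [if_pos hlink]
    refine inner_le_inner hμ fun x => ?_
    rw [mul_comm]
    refine (le_abs_self _).trans ?_
    rw [abs_mul]
    exact mul_le_mul (hAop _ _ _) (hAop _ _ _) (abs_nonneg _) (Real.sqrt_nonneg _)
  have := single_le_sum (fun S _ => hs0 S) (mem_univ S)
  linarith [hmain.2]

theorem norm4p4_sum_eq (𝒯 : Finset (Finset (Fin k))) (F : Finset (Fin k) → (∀ i, V i) → ℝ) :
    norm4p4 μ (fun x => ∑ T ∈ 𝒯, F T x) =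
      ∑ q ∈ 𝒯 ×ˢ 𝒯, ∑ r ∈ 𝒯 ×ˢ 𝒯,
        inner' μ (fun x => F q.1 x * F q.2 x) (fun x => F r.1 x * F r.2 x) := by
  have h : norm4p4 μ (fun x => ∑ T ∈ 𝒯, F T x) =
      inner' μ (fun x => ∑ q ∈ 𝒯 ×ˢ 𝒯, F q.1 x * F q.2 x)
        (fun x => ∑ q ∈ 𝒯 ×ˢ 𝒯, F q.1 x * F q.2 x) := by
    refine sum_congr rfl fun x _ => ?_
    have h₁ : ∑ q ∈ 𝒯 ×ˢ 𝒯, F q.1 x * F q.2 x = (∑ T ∈ 𝒯, F T x) ^ 2 := by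
      rw [sq, sum_mul_sum, ← sum_product']
    simp only [h₁]
    ring
  rw [h, inner_sum_left]
  refine sum_congr rfl fun q _ => ?_
  rw [inner_comm, inner_sum_left]
  exact sum_congr rfl fun r _ => inner_comm

theorem norm4p4_sum_ES_le (hμ : ∀ x, 0 ≤ μ x) {ε : ℝ} (hε : 0 ≤ ε)
    (hprod : EpsProduct μ ε) (hf : ∀ x, |f x| ≤ 1) (𝒯 : Finset (Finset (Fin k))) :
    norm4p4 μ (fun x => ∑ T ∈ 𝒯, relES μ ∅ T f x) ≤
      (∑ S : Finset (Fin k), ∑ x, μ x *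
        (∑ q ∈ (𝒯 ×ˢ 𝒯) with q.1 \ S = q.2 \ S ∧ S ⊆ q.1 ∪ q.2,
          √(Aop μ S (fun z => relES μ ∅ q.1 f z ^ 2) x *
            Aop μ S (fun z => relES μ ∅ q.2 f z ^ 2) x)) ^ 2) +
      (2 ^ k) ^ 8 * ((k : ℝ) ^ 2 * ε * normSq μ f) := by
  have hN := normSq_nonneg (f := f) hμ
  rw [norm4p4_sum_eq]
  refine (sum_le_sum fun q _ => sum_le_sum fun r _ =>
    inner_ES_mul_le hμ hε hprod hf q r).trans ?_
  simp only [sum_add_distrib, sum_const, nsmul_eq_mul, card_product]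
  refine add_le_add (le_of_eq ?_) ?_
  · simp only [sum_comm (s := 𝒯 ×ˢ 𝒯) (t := univ)]
    refine sum_congr rfl fun S _ => ?_
    have hsq : ∀ (p : Finset (Fin k) × Finset (Fin k) → Prop) [DecidablePred p]
        (b : Finset (Fin k) × Finset (Fin k) → (∀ i, V i) → ℝ),
        ∑ q ∈ 𝒯 ×ˢ 𝒯, ∑ r ∈ 𝒯 ×ˢ 𝒯, (if p q ∧ p r then ∑ x, μ x * (b q x * b r x) else 0) =
          ∑ x, μ x * (∑ q ∈ 𝒯 ×ˢ 𝒯 with p q, b q x) ^ 2 := by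
      intro p _ b
      simp only [sq, mul_sum]
      rw [sum_comm (s := univ), sum_filter]
      refine sum_congr rfl fun q _ => ?_
      by_cases hq : p q
      · simp only [hq, true_and, if_true]
        rw [← sum_filter, sum_comm]
        refine sum_congr rfl fun x _ => ?_
        rw [sum_mul, mul_sum]
        exact sum_congr rfl fun r _ => by ring
      · simp [hq]
    exact hsq (fun q => q.1 \ S = q.2 \ S ∧ S ⊆ q.1 ∪ q.2) fun q x =>
      √(Aop μ S (fun z => relES μ ∅ q.1 f z ^ 2) x *
        Aop μ S (fun z => relES μ ∅ q.2 f z ^ 2) x)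
  · have h := card_finset_le 𝒯
    push_cast
    calc _ ≤ ((2 : ℝ) ^ k * 2 ^ k) * ((2 ^ k * 2 ^ k) *
          ((2 ^ k) ^ 4 * ((k : ℝ) ^ 2 * ε * normSq μ f))) := by gcongr
      _ = _ := by ring

/-- The sum of the squared Efron–Stein components indexed by the members of `𝒯` above `J`. -/
noncomputable def upSq (μ : (∀ i, V i) → ℝ) (𝒯 : Finset (Finset (Fin k))) (J : Finset (Fin k))
    (f : (∀ i, V i) → ℝ) (x : ∀ i, V i) : ℝ :=
  ∑ T ∈ 𝒯 with J ⊆ T, relES μ ∅ T f x ^ 2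

theorem inner_Aop_Aop_sq_le (hμ : ∀ x, 0 ≤ μ x) {ε : ℝ} (hε : 0 ≤ ε)
    (hprod : EpsProduct μ ε) (hf : ∀ x, |f x| ≤ 1) (S T₁ T₂ : Finset (Fin k)) :
    inner' μ (Aop μ S fun x => relES μ ∅ T₁ f x ^ 2) (Aop μ S fun x => relES μ ∅ T₂ f x ^ 2) ≤
      inner' μ (Aop μ (S ∩ (T₁ ∩ T₂)) fun x => relES μ ∅ T₁ f x ^ 2)
        (fun x => relES μ ∅ T₂ f x ^ 2) +
      2 * ((2 ^ k) ^ 4 * ((k : ℝ) ^ 2 * ε * normSq μ f)) := by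
  set u₁ := fun x => relES μ ∅ T₁ f x ^ 2 with hu₁
  set u₂ := fun x => relES μ ∅ T₂ f x ^ 2 with hu₂
  have hn : ∀ T, l2norm μ (fun x => relES μ ∅ T f x ^ 2) ≤ (2 ^ k) ^ 2 * l2norm μ f := by
    intro T
    simp only [sq (relES μ ∅ T f _)]
    exact l2norm_relES_mul_le hμ hf
  have hnn : l2norm μ u₁ * l2norm μ u₂ ≤ (2 ^ k) ^ 2 * (2 ^ k) ^ 2 * normSq μ f :=
    l2norm_mul_le hμ (by positivity) (hn T₁) (hn T₂)
  have herr : (k : ℝ) ^ 2 * ε * (l2norm μ u₁ * l2norm μ u₂) ≤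
      (2 ^ k) ^ 4 * ((k : ℝ) ^ 2 * ε * normSq μ f) := by
    calc _ ≤ (k : ℝ) ^ 2 * ε * ((2 ^ k) ^ 2 * (2 ^ k) ^ 2 * normSq μ f) := by gcongr
      _ = _ := by ring
  have h₁ := (abs_le.1 (abs_inner_Aop_sub_le (u := u₁) hμ hε hprod S
    (junta_ES (μ := μ) (U := T₂) (f := f)).sq)).2
  have h₂ := (abs_le.1 (abs_inner_Aop_sub_le (u := u₂) hμ hε hprod (S ∩ T₂)
    (junta_ES (μ := μ) (U := T₁) (f := f)).sq)).2
  have hsymm : ∀ A, inner' μ (Aop μ A u₂) u₁ = inner' μ (Aop μ A u₁) u₂ := fun A => by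
    rw [inner_Aop_left, inner_comm]
  rw [← hu₂] at h₁
  rw [← hu₁, hsymm, hsymm, mul_comm (l2norm μ u₂)] at h₂
  rw [inner_comm, inner_Aop_of_junta hμ junta_Aop, inner_comm,
    show S ∩ (T₁ ∩ T₂) = S ∩ T₂ ∩ T₁ by rw [inter_comm T₁, inter_assoc]]
  linarith

theorem sum_inter_le {d : ℕ} {T₁ T₂ : Finset (Fin k)} (h₁ : T₁.card ≤ d) (h₂ : T₂.card ≤ d)
    {a : Finset (Fin k) → ℝ} (ha : ∀ J, 0 ≤ a J) :
    ∑ S : Finset (Fin k) with S ⊆ T₁ ∪ T₂, a (S ∩ (T₁ ∩ T₂)) ≤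
      4 ^ d * ∑ J : Finset (Fin k) with J ⊆ T₁ ∧ J ⊆ T₂, a J := by
  have hcard : (((univ : Finset (Finset (Fin k))).filter (· ⊆ T₁ ∪ T₂)).card : ℝ) ≤ 4 ^ d := by
    rw [show (univ : Finset (Finset (Fin k))).filter (· ⊆ T₁ ∪ T₂) = (T₁ ∪ T₂).powerset by
      ext; simp only [mem_filter, mem_univ, true_and, mem_powerset], card_powerset, show (4 : ℝ) ^ d = 2 ^ (2 * d) by rw [pow_mul]; norm_num]
    push_cast
    have := card_union_le T₁ T₂
    exact pow_le_pow_right₀ one_le_two (by omega)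
  refine (sum_le_card_nsmul _ _ _ fun S _ => single_le_sum (f := a) (fun J _ => ha J)
    (show S ∩ (T₁ ∩ T₂) ∈ (univ : Finset (Finset (Fin k))).filter
      (fun J => J ⊆ T₁ ∧ J ⊆ T₂) from ?_)).trans ?_
  · simp only [mem_filter, mem_univ, true_and]
    exact ⟨inter_subset_right.trans inter_subset_left, inter_subset_right.trans inter_subset_right⟩
  · rw [nsmul_eq_mul]
    exact mul_le_mul_of_nonneg_right hcard (sum_nonneg fun J _ => ha J)

theorem inner_Aop_upSq (𝒯 : Finset (Finset (Fin k))) (J : Finset (Fin k)) :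
    inner' μ (Aop μ J (upSq μ 𝒯 J f)) (upSq μ 𝒯 J f) =
      ∑ q ∈ (𝒯 ×ˢ 𝒯) with J ⊆ q.1 ∧ J ⊆ q.2,
        inner' μ (Aop μ J fun x => relES μ ∅ q.1 f x ^ 2) (fun x => relES μ ∅ q.2 f x ^ 2) := by
  have h : (upSq μ 𝒯 J f) = fun x => ∑ T ∈ 𝒯 with J ⊆ T, relES μ ∅ T f x ^ 2 := rfl
  rw [filter_product (J ⊆ ·) (J ⊆ ·), sum_product, inner_Aop_left, h, inner_sum_left]
  refine sum_congr rfl fun T _ => ?_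
  rw [← inner_Aop_left, inner_comm, inner_sum_left]
  exact sum_congr rfl fun T' _ => inner_comm

theorem norm4p4_sum_ES_le_upSq (hμ : ∀ x, 0 ≤ μ x) {ε : ℝ} (hε : 0 ≤ ε)
    (hprod : EpsProduct μ ε) (hf : ∀ x, |f x| ≤ 1) {d : ℕ} (hd : d ≤ k)
    {𝒯 : Finset (Finset (Fin k))} (h𝒯 : ∀ T ∈ 𝒯, T.card ≤ d) :
    norm4p4 μ (fun x => ∑ T ∈ 𝒯, relES μ ∅ T f x) ≤
      64 ^ d * ∑ J : Finset (Fin k), inner' μ (Aop μ J (upSq μ 𝒯 J f)) (upSq μ 𝒯 J f) +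
      3 * (2 ^ k) ^ 11 * ((k : ℝ) ^ 2 * ε * normSq μ f) := by
  set E := (k : ℝ) ^ 2 * ε * normSq μ f with hE
  have hE0 : 0 ≤ E := mul_nonneg (by positivity) (normSq_nonneg hμ)
  have hc1 : (1 : ℝ) ≤ 2 ^ k := one_le_pow₀ one_le_two
  have h16 : (16 : ℝ) ^ d ≤ (2 ^ k) ^ 4 := by
    rw [show (16 : ℝ) = 2 ^ 4 by norm_num, ← pow_mul, ← pow_mul]
    exact pow_le_pow_right₀ one_le_two (by omega)
  set φ : Finset (Fin k) × Finset (Fin k) → Finset (Fin k) → ℝ := fun q J =>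
    inner' μ (Aop μ J fun x => relES μ ∅ q.1 f x ^ 2) (fun x => relES μ ∅ q.2 f x ^ 2) with hφ
  have hφ0 : ∀ q J, 0 ≤ φ q J := fun q J => sum_nonneg fun x _ => mul_nonneg (hμ x)
    (mul_nonneg (Aop_nonneg hμ fun _ => sq_nonneg _) (sq_nonneg _))
  refine (norm4p4_sum_ES_le hμ hε hprod hf 𝒯).trans ?_
  have hS : ∀ S : Finset (Fin k), ∑ x, μ x *
      (∑ q ∈ (𝒯 ×ˢ 𝒯) with q.1 \ S = q.2 \ S ∧ S ⊆ q.1 ∪ q.2,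
        √(Aop μ S (fun z => relES μ ∅ q.1 f z ^ 2) x *
          Aop μ S (fun z => relES μ ∅ q.2 f z ^ 2) x)) ^ 2 ≤
      16 ^ d * (∑ q ∈ (𝒯 ×ˢ 𝒯) with S ⊆ q.1 ∪ q.2, φ q (S ∩ (q.1 ∩ q.2))) +
        (2 ^ k) ^ 4 * ((2 ^ k) ^ 2 * (2 * ((2 ^ k) ^ 4 * E))) := by
    intro S
    calc _ ≤ ∑ x, μ x * (16 ^ d * ∑ q ∈ (𝒯 ×ˢ 𝒯) with S ⊆ q.1 ∪ q.2,
          Aop μ S (fun z => relES μ ∅ q.1 f z ^ 2) x *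
            Aop μ S (fun z => relES μ ∅ q.2 f z ^ 2) x) :=
          sum_le_sum fun x _ => mul_le_mul_of_nonneg_left
            (sq_sum_sqrt_le (a := fun T => Aop μ S (fun z => relES μ ∅ T f z ^ 2) x) h𝒯
              (fun T => Aop_nonneg hμ fun _ => sq_nonneg _) S) (hμ x)
      _ = 16 ^ d * ∑ q ∈ (𝒯 ×ˢ 𝒯) with S ⊆ q.1 ∪ q.2,
          inner' μ (Aop μ S fun z => relES μ ∅ q.1 f z ^ 2)
            (Aop μ S fun z => relES μ ∅ q.2 f z ^ 2) := by
          unfold inner'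
          rw [sum_comm, mul_sum]
          refine sum_congr rfl fun x _ => ?_
          rw [← mul_sum]
          ring
      _ ≤ 16 ^ d * ∑ q ∈ (𝒯 ×ˢ 𝒯) with S ⊆ q.1 ∪ q.2,
          (φ q (S ∩ (q.1 ∩ q.2)) + 2 * ((2 ^ k) ^ 4 * E)) := by
          gcongr with q
          exact inner_Aop_Aop_sq_le hμ hε hprod hf S q.1 q.2
      _ = 16 ^ d * (∑ q ∈ (𝒯 ×ˢ 𝒯) with S ⊆ q.1 ∪ q.2, φ q (S ∩ (q.1 ∩ q.2))) +
          16 ^ d * ((((𝒯 ×ˢ 𝒯).filter fun q => S ⊆ q.1 ∪ q.2).card : ℝ) *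
            (2 * ((2 ^ k) ^ 4 * E))) := by
          rw [sum_add_distrib, sum_const, nsmul_eq_mul, mul_add]
      _ ≤ _ := by
          have h : (((𝒯 ×ˢ 𝒯).filter fun q => S ⊆ q.1 ∪ q.2).card : ℝ) ≤ (2 ^ k) ^ 2 := by
            calc _ ≤ ((𝒯 ×ˢ 𝒯).card : ℝ) := by exact_mod_cast card_filter_le _ _
              _ = (𝒯.card : ℝ) * 𝒯.card := by rw [card_product, Nat.cast_mul]
              _ ≤ 2 ^ k * 2 ^ k := by
                have := card_finset_le 𝒯
                gcongr
              _ = _ := by ring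
          gcongr
  have hswap : ∑ S : Finset (Fin k), ∑ q ∈ (𝒯 ×ˢ 𝒯) with S ⊆ q.1 ∪ q.2, φ q (S ∩ (q.1 ∩ q.2)) ≤
      4 ^ d * ∑ J : Finset (Fin k), inner' μ (Aop μ J (upSq μ 𝒯 J f)) (upSq μ 𝒯 J f) := by
    simp only [inner_Aop_upSq, sum_filter]
    rw [sum_comm, sum_comm (s := univ), mul_sum]
    refine sum_le_sum fun q hq => ?_
    rw [← sum_filter, ← sum_filter]
    exact sum_inter_le (h𝒯 _ (mem_product.1 hq).1) (h𝒯 _ (mem_product.1 hq).2) (hφ0 q)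
  have hcard : ((univ : Finset (Finset (Fin k))).card : ℝ) ≤ 2 ^ k := card_finset_le _
  calc _ ≤ ∑ S : Finset (Fin k),
          (16 ^ d * (∑ q ∈ (𝒯 ×ˢ 𝒯) with S ⊆ q.1 ∪ q.2, φ q (S ∩ (q.1 ∩ q.2))) +
            (2 ^ k) ^ 4 * ((2 ^ k) ^ 2 * (2 * ((2 ^ k) ^ 4 * E)))) + (2 ^ k) ^ 8 * E := by
        gcongr with S
        exact hS S
    _ ≤ 16 ^ d * (4 ^ d * ∑ J : Finset (Fin k),
          inner' μ (Aop μ J (upSq μ 𝒯 J f)) (upSq μ 𝒯 J f)) +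
        2 ^ k * ((2 ^ k) ^ 4 * ((2 ^ k) ^ 2 * (2 * ((2 ^ k) ^ 4 * E)))) + (2 ^ k) ^ 11 * E := by
        rw [sum_add_distrib, sum_const, nsmul_eq_mul, ← mul_sum]
        have h811 : ((2 : ℝ) ^ k) ^ 8 ≤ (2 ^ k) ^ 11 := pow_le_pow_right₀ hc1 (by norm_num)
        gcongr
    _ = _ := by
        rw [show (64 : ℝ) = 16 * 4 by norm_num, mul_pow]
        ring

theorem upSq_nonneg {𝒯 : Finset (Finset (Fin k))} {J : Finset (Fin k)} : 0 ≤ upSq μ 𝒯 J f x :=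
  sum_nonneg fun _ _ => sq_nonneg _

theorem sum_inner_relES_sq_le (hμ : ∀ x, 0 ≤ μ x) {ε : ℝ} (hε : 0 ≤ ε)
    (hprod : EpsProduct μ ε) (hφ : Junta B φ) (hφ0 : ∀ x, 0 ≤ φ x) :
    ∑ U ∈ Bᶜ.powerset, inner' μ φ (fun x => relES μ B U f x ^ 2) ≤
      (1 + 8 ^ k * ((k : ℝ) ^ 2 * ε)) * inner' μ φ (fun x => f x ^ 2) := by
  have hj : Junta B fun x => √(φ x) := fun x y h => by simp only [hφ x y h]
  have h : ∀ g : (∀ i, V i) → ℝ, inner' μ φ (fun x => g x ^ 2) =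
      normSq μ (fun x => √(φ x) * g x) := fun g =>
    sum_congr rfl fun x _ => by rw [mul_pow, Real.sq_sqrt (hφ0 x)]
  have h' : ∀ U, normSq μ (fun x => √(φ x) * relES μ B U f x) =
      normSq μ (relES μ B U fun x => √(φ x) * f x) := fun U =>
    sum_congr rfl fun x _ => by rw [relES_mul_junta hj]
  simp only [h, h']
  exact sum_normSq_relES_le hμ hε hprod B

theorem IsGlobal.Aop_sq_le (hμ : ∀ x, 0 ≤ μ x) {d : ℕ} {δ : ℝ} (hδ : 0 ≤ δ)
    (hf : IsGlobal μ d δ f) (hS : S.card ≤ d) (hx : 0 < μ x) :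
    Aop μ S (fun z => f z ^ 2) x ≤ δ ^ 2 :=
  (Real.sqrt_le_left hδ).1 (hf S hS x (marg_pos hμ hx))

theorem IsGlobal.inner_sq_le (hμ : ∀ x, 0 ≤ μ x) {d : ℕ} {δ : ℝ} (hδ : 0 ≤ δ)
    (hf : IsGlobal μ d δ f) (hB : B.card ≤ d) (hφ : Junta B φ) (hφ0 : ∀ x, 0 ≤ φ x) :
    inner' μ φ (fun x => f x ^ 2) ≤ δ ^ 2 * expect μ φ := by
  rw [inner_comm, ← inner_Aop_of_junta hμ hφ]
  unfold inner' expect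
  rw [mul_sum]
  refine sum_le_sum fun x _ => ?_
  rcases (hμ x).eq_or_lt with h0 | h0
  · simp [← h0]
  · rw [mul_left_comm (δ ^ 2)]
    exact mul_le_mul_of_nonneg_left
      (mul_le_mul_of_nonneg_right (hf.Aop_sq_le hμ hδ hB h0) (hφ0 x)) h0.le

theorem expect_Aop (hμ : ∀ x, 0 ≤ μ x) : expect μ (Aop μ S f) = expect μ f := by
  simpa [inner', expect] using inner_Aop_of_junta (S := S) (f := f) (g := fun _ => 1) hμ
    fun _ _ _ => rfl

theorem l2norm_upSq_le (hμ : ∀ x, 0 ≤ μ x) (hf : ∀ x, |f x| ≤ 1)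
    (𝒯 : Finset (Finset (Fin k))) (J : Finset (Fin k)) :
    l2norm μ (upSq μ 𝒯 J f) ≤ (2 ^ k) ^ 3 * l2norm μ f := by
  refine l2norm_le_of_normSq_le hμ (by positivity) ?_
  have hN := normSq_nonneg (f := f) hμ
  have hT : ∀ T, normSq μ (fun x => relES μ ∅ T f x ^ 2) ≤ (2 ^ k) ^ 4 * normSq μ f := by
    intro T
    rw [← l2norm_sq hμ, ← l2norm_sq hμ, show ((2 : ℝ) ^ k) ^ 4 = ((2 ^ k) ^ 2) ^ 2 by ring,
      ← mul_pow]
    refine pow_le_pow_left₀ l2norm_nonneg ?_ 2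
    simp only [sq (relES μ ∅ T f _)]
    exact l2norm_relES_mul_le hμ hf
  calc normSq μ (upSq μ 𝒯 J f)
      ≤ ∑ x, μ x * ((𝒯.filter (J ⊆ ·)).card *
          ∑ T ∈ 𝒯 with J ⊆ T, (relES μ ∅ T f x ^ 2) ^ 2) :=
        sum_le_sum fun x _ => mul_le_mul_of_nonneg_left sq_sum_le_card_mul_sum_sq (hμ x)
    _ = (𝒯.filter (J ⊆ ·)).card *
          ∑ T ∈ 𝒯 with J ⊆ T, normSq μ (fun x => relES μ ∅ T f x ^ 2) := by
        unfold normSq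
        rw [sum_comm, mul_sum]
        refine sum_congr rfl fun x _ => ?_
        rw [← mul_sum]
        ring
    _ ≤ 2 ^ k * (2 ^ k * ((2 ^ k) ^ 4 * normSq μ f)) := by
        refine mul_le_mul (card_finset_le _) ?_ (sum_nonneg fun T _ => normSq_nonneg hμ)
          (by positivity)
        refine (sum_le_card_nsmul _ _ _ fun T _ => hT T).trans ?_
        rw [nsmul_eq_mul]
        exact mul_le_mul_of_nonneg_right (card_finset_le _) (by positivity)
    _ = _ := by ring

theorem inner_Aop_upSq_le (hμ : ∀ x, 0 ≤ μ x) {ε : ℝ} (hε : 0 ≤ ε)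
    (hprod : EpsProduct μ ε) (hf : ∀ x, |f x| ≤ 1) {d : ℕ} {δ : ℝ} (hδ : 0 ≤ δ)
    (hglob : IsGlobal μ d δ f) (𝒯 : Finset (Finset (Fin k))) {J : Finset (Fin k)}
    (hJ : J.card ≤ d) :
    inner' μ (Aop μ J (upSq μ 𝒯 J f)) (upSq μ 𝒯 J f) ≤
      4 ^ d * ((1 + 8 ^ k * ((k : ℝ) ^ 2 * ε)) * δ ^ 2 * expect μ (upSq μ 𝒯 J f) +
        (2 ^ k) ^ 6 * ((k : ℝ) ^ 2 * ε * normSq μ f)) := by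
  set Z := upSq μ 𝒯 J f with hZ
  have hZ0 : ∀ x, 0 ≤ Z x := fun x => upSq_nonneg
  have hA0 : ∀ S x, 0 ≤ Aop μ S Z x := fun S x => Aop_nonneg hμ hZ0
  set E := (k : ℝ) ^ 2 * ε * normSq μ f with hE
  have hE0 : 0 ≤ E := mul_nonneg (by positivity) (normSq_nonneg hμ)
  have hEZ : 0 ≤ expect μ Z := sum_nonneg fun x _ => mul_nonneg (hμ x) (hZ0 x)
  set w : Finset (Fin k) → Finset (Fin k) → (∀ i, V i) → ℝ :=
    fun J' U x => relES μ J' U f x ^ 2 with hw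
  have hpt : ∀ x, Z x ≤ ∑ J' ∈ J.powerset, ∑ T ∈ 𝒯 with J ⊆ T, 2 ^ J.card * w J' (T \ J) x := by
    intro x
    rw [sum_comm]
    refine sum_le_sum fun T hT => ?_
    have := relES_union_sq_le (μ := μ) (B := ∅) (U := T \ J) (f := f) (x := x)
      (disjoint_sdiff (s := J) (t := T))
    rw [union_sdiff_of_subset (mem_filter.1 hT).2] at this
    simpa only [empty_union, mul_sum] using this
  have hterm : ∀ J' ∈ J.powerset, ∀ T ∈ 𝒯.filter (J ⊆ ·),
      inner' μ (w J' (T \ J)) (Aop μ J Z) ≤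
        inner' μ (Aop μ J' Z) (w J' (T \ J)) + (2 ^ k) ^ 5 * E := by
    intro J' hJ' T _
    have h := (abs_le.1 (abs_inner_Aop_sub_le (u := Z) hμ hε hprod J
      (junta_relES (μ := μ) (B := J') (U := T \ J) (f := f)).sq)).2
    rw [show J ∩ (J' ∪ T \ J) = J' by
      rw [inter_union_distrib_left, inter_sdiff_self, union_empty,
        inter_eq_right.2 (mem_powerset.1 hJ')]] at h
    have hn : l2norm μ (fun x => relES μ J' (T \ J) f x ^ 2) ≤ (2 ^ k) ^ 2 * l2norm μ f := by
      simp only [sq (relES μ J' (T \ J) f _)]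
      exact l2norm_relES_mul_le hμ hf
    have hnn := l2norm_mul_le hμ (by positivity) (l2norm_upSq_le hμ hf 𝒯 J) hn
    have herr : (k : ℝ) ^ 2 * ε * (l2norm μ Z * l2norm μ fun x => relES μ J' (T \ J) f x ^ 2) ≤
        (2 ^ k) ^ 5 * E := by
      calc _ ≤ (k : ℝ) ^ 2 * ε * ((2 ^ k) ^ 3 * (2 ^ k) ^ 2 * normSq μ f) := by gcongr
        _ = _ := by rw [hE]; ring
    rw [inner_comm]
    linarith
  have hmain : ∀ J' ∈ J.powerset, ∑ T ∈ 𝒯 with J ⊆ T, inner' μ (Aop μ J' Z) (w J' (T \ J)) ≤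
      (1 + 8 ^ k * ((k : ℝ) ^ 2 * ε)) * δ ^ 2 * expect μ Z := by
    intro J' hJ'
    have hinj : Set.InjOn (· \ J) (𝒯.filter (J ⊆ ·) : Set (Finset (Fin k))) := by
      intro T hT T' hT' h
      rw [mem_coe, mem_filter] at hT hT'
      rw [← sdiff_union_of_subset hT.2, ← sdiff_union_of_subset hT'.2]
      exact congrArg (· ∪ J) h
    have hsub : (𝒯.filter (J ⊆ ·)).image (· \ J) ⊆ J'ᶜ.powerset := by
      intro U hU
      obtain ⟨T, _, rfl⟩ := mem_image.1 hU
      refine mem_powerset.2 (subset_compl_iff_disjoint_right.2 ?_)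
      exact sdiff_disjoint.mono_right (mem_powerset.1 hJ')
    calc _ = ∑ U ∈ (𝒯.filter (J ⊆ ·)).image (· \ J), inner' μ (Aop μ J' Z) (w J' U) :=
          (sum_image (f := fun U => inner' μ (Aop μ J' Z) (w J' U)) hinj).symm
      _ ≤ ∑ U ∈ J'ᶜ.powerset, inner' μ (Aop μ J' Z) (w J' U) :=
          sum_le_sum_of_subset_of_nonneg hsub fun U _ _ => sum_nonneg fun x _ =>
            mul_nonneg (hμ x) (mul_nonneg (hA0 _ _) (sq_nonneg _))
      _ ≤ (1 + 8 ^ k * ((k : ℝ) ^ 2 * ε)) * inner' μ (Aop μ J' Z) (fun x => f x ^ 2) :=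
          sum_inner_relES_sq_le hμ hε hprod junta_Aop (hA0 J')
      _ ≤ (1 + 8 ^ k * ((k : ℝ) ^ 2 * ε)) * (δ ^ 2 * expect μ (Aop μ J' Z)) :=
          mul_le_mul_of_nonneg_left (hglob.inner_sq_le hμ hδ
            ((card_le_card (mem_powerset.1 hJ')).trans hJ) junta_Aop (hA0 J')) (by positivity)
      _ = _ := by rw [expect_Aop hμ, mul_assoc]
  have h2 : (2 : ℝ) ^ J.card ≤ 2 ^ d := pow_le_pow_right₀ one_le_two hJ
  set M := (1 + 8 ^ k * ((k : ℝ) ^ 2 * ε)) * δ ^ 2 * expect μ Z + (2 ^ k) ^ 6 * E with hM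
  have hM0 : 0 ≤ M := by positivity
  calc inner' μ (Aop μ J Z) Z
      ≤ inner' μ (fun x => ∑ J' ∈ J.powerset, ∑ T ∈ 𝒯 with J ⊆ T, 2 ^ J.card * w J' (T \ J) x)
          (Aop μ J Z) :=
        inner_le_inner hμ fun x => by
          rw [mul_comm]
          exact mul_le_mul_of_nonneg_right (hpt x) (hA0 J x)
    _ = 2 ^ J.card * ∑ J' ∈ J.powerset, ∑ T ∈ 𝒯 with J ⊆ T,
          inner' μ (w J' (T \ J)) (Aop μ J Z) := by
        simp only [inner_sum_left, inner_const_mul_left, mul_sum]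
    _ ≤ 2 ^ J.card * ∑ J' ∈ J.powerset, M := by
        refine mul_le_mul_of_nonneg_left (sum_le_sum fun J' hJ' => ?_) (by positivity)
        refine (sum_le_sum (hterm J' hJ')).trans ?_
        rw [sum_add_distrib, sum_const, nsmul_eq_mul, hM]
        refine add_le_add (hmain J' hJ') ?_
        calc _ ≤ 2 ^ k * ((2 ^ k) ^ 5 * E) :=
              mul_le_mul_of_nonneg_right (card_finset_le _) (by positivity)
          _ = _ := by ring
    _ = 2 ^ J.card * (2 ^ J.card * M) := by
        rw [sum_const, card_powerset, nsmul_eq_mul]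
        push_cast
        rfl
    _ ≤ 2 ^ d * (2 ^ d * M) := by gcongr
    _ = 4 ^ d * M := by
        rw [show (4 : ℝ) = 2 * 2 by norm_num, mul_pow]
        ring

theorem sum_expect_upSq_le (hμ : ∀ x, 0 ≤ μ x) {ε : ℝ} (hε : 0 ≤ ε)
    (hprod : EpsProduct μ ε) {d : ℕ} {𝒯 : Finset (Finset (Fin k))}
    (h𝒯 : ∀ T ∈ 𝒯, T.card ≤ d) :
    ∑ J : Finset (Fin k), expect μ (upSq μ 𝒯 J f) ≤
      2 ^ d * ((1 + 8 ^ k * ((k : ℝ) ^ 2 * ε)) * normSq μ f) := by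
  have h : ∀ J, expect μ (upSq μ 𝒯 J f) =
      ∑ T ∈ 𝒯, if J ⊆ T then normSq μ (relES μ ∅ T f) else 0 := by
    intro J
    unfold expect upSq normSq
    simp only [mul_sum]
    rw [sum_comm, sum_filter]
  calc ∑ J : Finset (Fin k), expect μ (upSq μ 𝒯 J f)
      = ∑ T ∈ 𝒯, 2 ^ T.card * normSq μ (relES μ ∅ T f) := by
        simp only [h]
        rw [sum_comm]
        refine sum_congr rfl fun T _ => ?_
        rw [← sum_filter, sum_const, nsmul_eq_mul,
          show (univ : Finset (Finset (Fin k))).filter (· ⊆ T) = T.powerset by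
            ext; simp only [mem_filter, mem_univ, true_and, mem_powerset], card_powerset]
        push_cast
        rfl
    _ ≤ ∑ T ∈ 𝒯, 2 ^ d * normSq μ (relES μ ∅ T f) :=
        sum_le_sum fun T hT => mul_le_mul_of_nonneg_right
          (pow_le_pow_right₀ one_le_two (h𝒯 T hT)) (normSq_nonneg hμ)
    _ ≤ ∑ T ∈ (∅ : Finset (Fin k))ᶜ.powerset, 2 ^ d * normSq μ (relES μ ∅ T f) :=
        sum_le_sum_of_subset_of_nonneg (fun T _ => by simp)
          fun T _ _ => mul_nonneg (by positivity) (normSq_nonneg hμ)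
    _ ≤ _ := by
        rw [← mul_sum]
        exact mul_le_mul_of_nonneg_left (sum_normSq_relES_le hμ hε hprod ∅) (by positivity)

/-- Hypercontractivity for the low-degree part of a global function. -/
theorem norm4p4_sum_ES_le_normSq (hμ : ∀ x, 0 ≤ μ x) {ε : ℝ} (hε : 0 ≤ ε)
    (hprod : EpsProduct μ ε) (hε₁ : 8 ^ k * ((k : ℝ) ^ 2 * ε) ≤ 1) (hf : ∀ x, |f x| ≤ 1)
    {d : ℕ} (hd : d ≤ k) {δ : ℝ} (hδ : 0 ≤ δ) (hglob : IsGlobal μ d δ f)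
    {𝒯 : Finset (Finset (Fin k))} (h𝒯 : ∀ T ∈ 𝒯, T.card ≤ d) :
    norm4p4 μ (fun x => ∑ T ∈ 𝒯, relES μ ∅ T f x) ≤
      (4 * 512 ^ d * δ ^ 2 + 4 * (2 ^ k) ^ 15 * ((k : ℝ) ^ 2 * ε)) * normSq μ f := by
  set E := (k : ℝ) ^ 2 * ε * normSq μ f with hE
  have hN := normSq_nonneg (f := f) hμ
  have hE0 : 0 ≤ E := mul_nonneg (by positivity) hN
  have hc1 : (1 : ℝ) ≤ 2 ^ k := one_le_pow₀ one_le_two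
  have h64 : (64 : ℝ) ^ d ≤ (2 ^ k) ^ 6 := by
    rw [show (64 : ℝ) = 2 ^ 6 by norm_num, ← pow_mul, ← pow_mul]
    exact pow_le_pow_right₀ one_le_two (by omega)
  have h4 : (4 : ℝ) ^ d ≤ (2 ^ k) ^ 2 := by
    rw [show (4 : ℝ) = 2 ^ 2 by norm_num, ← pow_mul, ← pow_mul]
    exact pow_le_pow_right₀ one_le_two (by omega)
  set m := 1 + 8 ^ k * ((k : ℝ) ^ 2 * ε) with hm
  have hm0 : 0 ≤ m := by positivity
  have hm2 : m ≤ 2 := by linarith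
  have hJ : ∀ J : Finset (Fin k), inner' μ (Aop μ J (upSq μ 𝒯 J f)) (upSq μ 𝒯 J f) ≤
      4 ^ d * (m * δ ^ 2 * expect μ (upSq μ 𝒯 J f) + (2 ^ k) ^ 6 * E) := by
    intro J
    by_cases hJ : J.card ≤ d
    · exact inner_Aop_upSq_le hμ hε hprod hf hδ hglob 𝒯 hJ
    · have h0 : ∀ x, upSq μ 𝒯 J f x = 0 := fun x => by
        unfold upSq
        rw [filter_eq_empty_iff.2 fun T hT hJT => hJ ((card_le_card hJT).trans (h𝒯 T hT)),
          sum_empty]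
      have h1 : inner' μ (Aop μ J (upSq μ 𝒯 J f)) (upSq μ 𝒯 J f) = 0 := by
        simp [inner', h0]
      have h2 : 0 ≤ expect μ (upSq μ 𝒯 J f) := by simp [expect, h0]
      rw [h1]
      positivity
  have hsum : ∑ J : Finset (Fin k), inner' μ (Aop μ J (upSq μ 𝒯 J f)) (upSq μ 𝒯 J f) ≤
      4 ^ d * (2 * δ ^ 2 * (2 ^ d * (2 * normSq μ f))) + 4 ^ d * (2 ^ k * ((2 ^ k) ^ 6 * E)) := by
    refine (sum_le_sum fun J _ => hJ J).trans ?_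
    rw [← mul_sum, sum_add_distrib, ← mul_sum, sum_const, nsmul_eq_mul, mul_add]
    have h1 := sum_expect_upSq_le (f := f) hμ hε hprod h𝒯
    have h2 : ((univ : Finset (Finset (Fin k))).card : ℝ) ≤ 2 ^ k := card_finset_le _
    have h3 : m * δ ^ 2 * ∑ J : Finset (Fin k), expect μ (upSq μ 𝒯 J f) ≤
        2 * δ ^ 2 * (2 ^ d * (2 * normSq μ f)) :=
      calc _ ≤ m * δ ^ 2 * (2 ^ d * (m * normSq μ f)) :=
            mul_le_mul_of_nonneg_left h1 (by positivity)
        _ ≤ _ := by gcongr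
    gcongr
  have h1115 : ((2 : ℝ) ^ k) ^ 11 ≤ (2 ^ k) ^ 15 := pow_le_pow_right₀ hc1 (by norm_num)
  calc _ ≤ 64 ^ d * (4 ^ d * (2 * δ ^ 2 * (2 ^ d * (2 * normSq μ f))) +
          4 ^ d * (2 ^ k * ((2 ^ k) ^ 6 * E))) + 3 * (2 ^ k) ^ 11 * E :=
        (norm4p4_sum_ES_le_upSq hμ hε hprod hf hd h𝒯).trans (by gcongr)
    _ = 4 * (64 ^ d * 4 ^ d * 2 ^ d) * δ ^ 2 * normSq μ f +
          64 ^ d * (4 ^ d * (2 ^ k * ((2 ^ k) ^ 6 * E))) + 3 * (2 ^ k) ^ 11 * E := by ring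
    _ ≤ 4 * (64 ^ d * 4 ^ d * 2 ^ d) * δ ^ 2 * normSq μ f +
          (2 ^ k) ^ 6 * ((2 ^ k) ^ 2 * (2 ^ k * ((2 ^ k) ^ 6 * E))) + 3 * (2 ^ k) ^ 15 * E := by
        gcongr
    _ = _ := by
        rw [← mul_pow, ← mul_pow, hE]
        norm_num
        ring

theorem lowPart_eq {d : ℕ} : lowPart μ d f = fun x =>
    ∑ T ∈ univ.powerset with T.card ≤ d, relES μ ∅ T f x := by
  simp only [relES_empty_left]
  rfl

theorem normSq_sum_ES_le (hμ : ∀ x, 0 ≤ μ x) {ε : ℝ} (hε : 0 ≤ ε) (hprod : EpsProduct μ ε)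
    (𝒯 : Finset (Finset (Fin k))) :
    normSq μ (fun x => ∑ T ∈ 𝒯, relES μ ∅ T f x) ≤
      inner' μ (fun x => ∑ T ∈ 𝒯, relES μ ∅ T f x) f +
        (2 ^ k) ^ 4 * ((k : ℝ) ^ 2 * ε * normSq μ f) := by
  set E := (k : ℝ) ^ 2 * ε * normSq μ f with hE
  have hE0 : 0 ≤ E := mul_nonneg (by positivity) (normSq_nonneg hμ)
  have hne : ∀ T T', ¬ T ⊆ T' → inner' μ (relES μ ∅ T f) (relES μ ∅ T' f) ≤ (2 ^ k) ^ 2 * E := by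
    intro T T' h
    refine ((le_abs_self _).trans
      (abs_inner_relES_le hμ hε hprod junta_ES (disjoint_empty_left _) h)).trans ?_
    have := l2norm_mul_le (u := f) (v := relES μ ∅ T' f) hμ zero_le_one (one_mul _).ge
      (l2norm_relES_le hμ)
    calc _ ≤ 2 ^ k * ((k : ℝ) ^ 2 * ε * (1 * 2 ^ k * normSq μ f)) := by gcongr
      _ = _ := by rw [hE]; ring
  have hpair : ∀ T T', inner' μ (relES μ ∅ T f) (relES μ ∅ T' f) ≤
      (if T = T' then inner' μ (relES μ ∅ T f) f else 0) + (2 ^ k) ^ 2 * E := by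
    intro T T'
    split_ifs with h
    · subst h
      have h₁ := (abs_le.1 (abs_inner_relES_self_sub_le (f := f) hμ hε hprod
        (disjoint_empty_left T))).2
      rw [show (4 : ℝ) ^ k = (2 ^ k) ^ 2 by rw [← pow_mul, mul_comm k, pow_mul]; norm_num] at h₁
      linarith
    · rw [zero_add]
      by_cases h₁ : T ⊆ T'
      · rw [inner_comm]
        exact hne _ _ fun h₂ => h (subset_antisymm h₁ h₂)
      · exact hne _ _ h₁
  have hexp : normSq μ (fun x => ∑ T ∈ 𝒯, relES μ ∅ T f x) =
      ∑ T ∈ 𝒯, ∑ T' ∈ 𝒯, inner' μ (relES μ ∅ T f) (relES μ ∅ T' f) := by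
    rw [normSq_eq_inner, inner_sum_left]
    refine sum_congr rfl fun T _ => ?_
    rw [inner_comm, inner_sum_left]
    exact sum_congr rfl fun T' _ => inner_comm
  rw [hexp, inner_sum_left]
  calc _ ≤ ∑ T ∈ 𝒯, ∑ T' ∈ 𝒯, ((if T = T' then inner' μ (relES μ ∅ T f) f else 0) +
          (2 ^ k) ^ 2 * E) := sum_le_sum fun T _ => sum_le_sum fun T' _ => hpair T T'
    _ = ∑ T ∈ 𝒯, inner' μ (relES μ ∅ T f) f +
          (𝒯.card : ℝ) * ((𝒯.card : ℝ) * ((2 ^ k) ^ 2 * E)) := by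
        simp only [sum_add_distrib, sum_const, nsmul_eq_mul, sum_ite_eq]
        congr 1
        exact sum_congr rfl fun T hT => if_pos hT
    _ ≤ ∑ T ∈ 𝒯, inner' μ (relES μ ∅ T f) f + 2 ^ k * (2 ^ k * ((2 ^ k) ^ 2 * E)) := by
        have := card_finset_le 𝒯
        gcongr
    _ = _ := by ring

theorem inner_le_mul_normSq (hμ : ∀ x, 0 ≤ μ x) (hf : ∀ x, f x = 0 ∨ f x = 1) {b : ℝ}
    (hg : ∀ x, 0 < μ x → |g x| ≤ b) : inner' μ g f ≤ b * normSq μ f := by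
  unfold inner' normSq
  rw [mul_sum]
  refine sum_le_sum fun x _ => ?_
  rcases (hμ x).eq_or_lt with h0 | h0
  · simp [← h0]
  · rw [mul_left_comm b]
    refine mul_le_mul_of_nonneg_left ?_ h0.le
    have := (le_abs_self _).trans (hg x h0)
    rcases hf x with h | h <;> simp [h, this]

theorem IsGlobal.abs_Aop_le (hμ : ∀ x, 0 ≤ μ x) (hf : ∀ x, f x = 0 ∨ f x = 1) {d : ℕ} {δ : ℝ}
    (hδ : 0 ≤ δ) (hglob : IsGlobal μ d δ f) (hS : S.card ≤ d) (hx : 0 < μ x) :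
    |Aop μ S f x| ≤ δ ^ 2 := by
  have h : (fun z => f z ^ 2) = f := funext fun z => by rcases hf z with h | h <;> simp [h]
  rw [abs_of_nonneg (Aop_nonneg hμ fun z => by rcases hf z with h | h <;> simp [h])]
  have := hglob.Aop_sq_le hμ hδ hS hx
  rwa [h] at this

theorem inner_pow_four_le (hμ : ∀ x, 0 ≤ μ x) (hf : ∀ x, f x = 0 ∨ f x = 1) :
    inner' μ g f ^ 4 ≤ normSq μ f ^ 3 * norm4p4 μ g := by
  have h₁ : inner' μ g f = inner' μ f (fun x => f x * g x) := sum_congr rfl fun x _ => by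
    rcases hf x with h | h <;> simp [h]
  have h₂ : normSq μ (fun x => f x * g x) = inner' μ f (fun x => g x ^ 2) :=
    sum_congr rfl fun x _ => by rcases hf x with h | h <;> simp [h]
  have h₃ : normSq μ (fun x => g x ^ 2) = norm4p4 μ g := sum_congr rfl fun x _ => by
    rw [← pow_mul]
  have h₄ := sq_inner_le (f := f) (g := fun x => g x ^ 2) hμ
  calc inner' μ g f ^ 4 = (inner' μ g f ^ 2) ^ 2 := by ring
    _ ≤ (normSq μ f * normSq μ fun x => f x * g x) ^ 2 := by
        rw [h₁]
        exact pow_le_pow_left₀ (sq_nonneg _) (sq_inner_le hμ) 2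
    _ = normSq μ f ^ 2 * inner' μ f (fun x => g x ^ 2) ^ 2 := by rw [h₂, mul_pow]
    _ ≤ normSq μ f ^ 2 * (normSq μ f * norm4p4 μ g) := by
        rw [← h₃]
        exact mul_le_mul_of_nonneg_left h₄ (sq_nonneg _)
    _ = _ := by ring

theorem four_mul_pow_add_one_le {d : ℕ} (hd : d ≠ 0) :
    4 * (512 : ℝ) ^ d + 1 ≤ ((200 * d) ^ d) ^ 4 := by
  have hd1 : (1 : ℝ) ≤ d := by exact_mod_cast Nat.one_le_iff_ne_zero.2 hd
  have h5 : (5 : ℝ) ≤ 5 ^ d := le_self_pow₀ (by norm_num) hd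
  have h512 : (1 : ℝ) ≤ 512 ^ d := one_le_pow₀ (by norm_num)
  calc 4 * (512 : ℝ) ^ d + 1 ≤ 5 * 512 ^ d := by linarith
    _ ≤ 5 ^ d * 512 ^ d := by gcongr
    _ = 2560 ^ d := by rw [← mul_pow]; norm_num
    _ ≤ ((200 * d) ^ 4) ^ d := by
        refine pow_le_pow_left₀ (by norm_num) ?_ d
        calc (2560 : ℝ) ≤ (200 * 1) ^ 4 := by norm_num
          _ ≤ (200 * d) ^ 4 := by gcongr
    _ = _ := by rw [← pow_mul, ← pow_mul, mul_comm 4]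

theorem inner_lowPart_le (hμ : ∀ x, 0 ≤ μ x) {ε : ℝ} (hε : 0 ≤ ε) (hε₁ : ε ≤ 1)
    (hprod : EpsProduct μ ε) (hε₂ : 8 ^ k * ((k : ℝ) ^ 2 * ε) ≤ 1)
    (hf : ∀ x, f x = 0 ∨ f x = 1) {d : ℕ} (hd : d ≤ k) {δ : ℝ} (hδ : 0 < δ)
    (hglob : IsGlobal μ d δ f) :
    inner' μ (lowPart μ d f) f ≤
      ((2 ^ k) ^ 2 * (4 * (2 ^ k) ^ 15 * (k : ℝ) ^ 2) * √ε + (200 * (d : ℝ)) ^ d * √δ) *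
        normSq μ f := by
  have hN := normSq_nonneg (f := f) hμ
  have habs : ∀ x, |f x| ≤ 1 := fun x => by rcases hf x with h | h <;> simp [h]
  set K := 4 * ((2 : ℝ) ^ k) ^ 15 * (k : ℝ) ^ 2 with hK
  have hK0 : 0 ≤ K := by positivity
  rcases eq_or_ne d 0 with rfl | hd0
  · have hlow : lowPart μ 0 f = Aop μ ∅ f := by
      ext x
      simp only [lowPart_eq, Nat.le_zero, card_eq_zero, powerset_univ, filter_eq', mem_univ,
        if_true, sum_singleton, relES_empty_right]
    have h : inner' μ (lowPart μ 0 f) f ≤ √δ * normSq μ f := by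
      refine inner_le_mul_normSq hμ hf fun x hx => ?_
      rw [hlow]
      rcases le_total δ 1 with h1 | h1
      · refine (hglob.abs_Aop_le hμ hf hδ.le (by simp) hx).trans ?_
        refine Real.le_sqrt_of_sq_le ?_
        calc (δ ^ 2) ^ 2 = δ ^ 3 * δ := by ring
          _ ≤ 1 * δ := mul_le_mul_of_nonneg_right (pow_le_one₀ hδ.le h1) hδ.le
          _ = δ := one_mul _
      · exact (GLL.abs_Aop_le hμ zero_le_one habs).trans (Real.one_le_sqrt.2 h1)
    refine h.trans (mul_le_mul_of_nonneg_right ?_ hN)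
    rw [pow_zero, one_mul]
    exact le_add_of_nonneg_left (by positivity)
  rcases le_total (δ ^ 2) (K * √ε) with hδε | hδε
  · have h : inner' μ (lowPart μ d f) f ≤ 2 ^ k * (2 ^ k * δ ^ 2) * normSq μ f := by
      refine inner_le_mul_normSq hμ hf fun x hx => ?_
      rw [lowPart_eq]
      refine (abs_sum_le_sum_abs _ _).trans ((sum_le_card_nsmul _ _ (2 ^ k * δ ^ 2)
        fun T hT => ?_).trans ?_)
      · refine abs_relES_le fun W hW => hglob.abs_Aop_le hμ hf hδ.le ?_ hx
        rw [empty_union]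
        exact (card_le_card hW).trans (mem_filter.1 hT).2
      · rw [nsmul_eq_mul]
        exact mul_le_mul_of_nonneg_right (card_finset_le _) (by positivity)
    refine h.trans (mul_le_mul_of_nonneg_right ?_ hN)
    calc (2 : ℝ) ^ k * (2 ^ k * δ ^ 2) = (2 ^ k) ^ 2 * δ ^ 2 := by ring
      _ ≤ (2 ^ k) ^ 2 * (K * √ε) := by gcongr
      _ = (2 ^ k) ^ 2 * K * √ε := by ring
      _ ≤ _ := le_add_of_nonneg_right (by positivity)
  · set X := (200 * (d : ℝ)) ^ d * √δ with hX
    have hX0 : 0 ≤ X := by positivity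
    have hεs : ε ≤ √ε := Real.le_sqrt_of_sq_le (by nlinarith)
    have h4 : norm4p4 μ (lowPart μ d f) ≤ X ^ 4 * normSq μ f := by
      rw [lowPart_eq]
      refine (norm4p4_sum_ES_le_normSq hμ hε hprod hε₂ habs hd hδ.le hglob
        fun T hT => (mem_filter.1 hT).2).trans (mul_le_mul_of_nonneg_right ?_ hN)
      calc 4 * 512 ^ d * δ ^ 2 + 4 * (2 ^ k) ^ 15 * ((k : ℝ) ^ 2 * ε)
          = 4 * 512 ^ d * δ ^ 2 + K * ε := by rw [hK]; ring
        _ ≤ 4 * 512 ^ d * δ ^ 2 + δ ^ 2 :=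
            add_le_add_right ((mul_le_mul_of_nonneg_left hεs hK0).trans hδε) _
        _ = (4 * 512 ^ d + 1) * δ ^ 2 := by ring
        _ ≤ ((200 * d) ^ d) ^ 4 * δ ^ 2 :=
            mul_le_mul_of_nonneg_right (four_mul_pow_add_one_le hd0) (sq_nonneg _)
        _ = X ^ 4 := by
            rw [hX, mul_pow _ √δ, show √δ ^ 4 = (√δ ^ 2) ^ 2 by ring, Real.sq_sqrt hδ.le]
    have h : |inner' μ (lowPart μ d f) f| ≤ X * normSq μ f := by
      rw [← pow_le_pow_iff_left₀ (abs_nonneg _) (by positivity) four_ne_zero,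
        (by decide : Even 4).pow_abs]
      calc _ ≤ normSq μ f ^ 3 * norm4p4 μ (lowPart μ d f) := inner_pow_four_le hμ hf
        _ ≤ normSq μ f ^ 3 * (X ^ 4 * normSq μ f) := by gcongr
        _ = _ := by ring
    refine ((le_abs_self _).trans h).trans (mul_le_mul_of_nonneg_right ?_ hN)
    exact le_add_of_nonneg_left (by positivity)

theorem statement2 (k : ℕ) (hk : 1 ≤ k) :
    ∃ ε₀ C : ℝ, 0 < ε₀ ∧ 0 < C ∧
      ∀ (V : Fin k → Type) [∀ i, Fintype (V i)] [∀ i, DecidableEq (V i)]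
        (μ : (∀ i, V i) → ℝ) (ε δ : ℝ) (d : ℕ) (f : (∀ i, V i) → ℝ),
        0 < ε → ε ≤ ε₀ → IsProb μ → EpsProduct μ ε → d ≤ k → 0 < δ →
        (∀ x, f x = 0 ∨ f x = 1) → IsGlobal μ d δ f →
        normSq μ (lowPart μ d f) ≤
          (C * Real.sqrt ε + (200 * (d : ℝ)) ^ d * Real.sqrt δ) * normSq μ f := by
  have hk1 : (1 : ℝ) ≤ k := by exact_mod_cast hk
  have hD : (1 : ℝ) ≤ 8 ^ k * (k : ℝ) ^ 2 :=
    one_le_mul_of_one_le_of_one_le (one_le_pow₀ (by norm_num)) (one_le_pow₀ hk1)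
  refine ⟨1 / (8 ^ k * (k : ℝ) ^ 2),
    (2 ^ k) ^ 2 * (4 * (2 ^ k) ^ 15 * (k : ℝ) ^ 2) + (2 ^ k) ^ 4 * (k : ℝ) ^ 2,
    by positivity, by positivity, ?_⟩
  intro V _ _ μ ε δ d f hε hεε₀ hprob hprod hd hδ hf hglob
  have hμ := hprob.1
  have hε₂ : 8 ^ k * ((k : ℝ) ^ 2 * ε) ≤ 1 := by
    rw [le_div_iff₀ (by positivity)] at hεε₀
    linarith
  have hε₁ : ε ≤ 1 := hεε₀.trans ((div_le_one (by positivity)).2 hD)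
  have hεs : ε ≤ √ε := Real.le_sqrt_of_sq_le (by nlinarith)
  have h₁ := inner_lowPart_le hμ hε.le hε₁ hprod hε₂ hf hd hδ hglob
  have h₂ := normSq_sum_ES_le (f := f) hμ hε.le hprod
    (univ.powerset.filter fun T : Finset (Fin k) => T.card ≤ d)
  rw [← lowPart_eq] at h₂
  have h₃ : (2 ^ k) ^ 4 * ((k : ℝ) ^ 2 * ε * normSq μ f) ≤
      (2 ^ k) ^ 4 * ((k : ℝ) ^ 2 * √ε * normSq μ f) := by
    have := normSq_nonneg (f := f) hμ
    gcongr
  linarith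

end GLL
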